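/- Let f be a mixing piecewise expanding C^3 unimodal map with invariant density ρ₀, and write ρ₀ = ρ_reg + ρ_sal, its unique decomposition into a continuous part and a saltus part. Then ρ_reg belongs to BV^{(1)}, i.e. ρ_reg is supported in (−∞,b] and its derivative is a function of bounded variation. -/

import Mathlib

open Set MeasureTheory Filter Topology

noncomputable section

/-- A piecewise expanding `C^r` unimodal map on `I = [a,b]` with critical (turning) point `c`:
`f` is continuous on `I`, strictly increasing on `[a,c]`, strictly decreasing on `[c,b]`,
`f(a) = f(b) = a`, and on each side the map extends to a `C^r` map (`fp`, resp. `fm`) on an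
open neighbourhood (`Up`, resp. `Um`) with derivative bounded below in modulus by some `κ > 1`. -/
structure PWUnimodal (r : ℕ) where
  a : ℝ
  b : ℝ
  c : ℝ
  hac : a < c
  hcb : c < b
  f : ℝ → ℝ
  cont : ContinuousOn f (Set.Icc a b)
  mapsI : Set.MapsTo f (Set.Icc a b) (Set.Icc a b)
  mono : StrictMonoOn f (Set.Icc a c)
  anti : StrictAntiOn f (Set.Icc c b)
  fa : f a = a
  fb : f b = a
  Up : Set ℝ
  Um : Set ℝ
  openUp : IsOpen Up
  openUm : IsOpen Um
  subUp : Set.Icc a c ⊆ Up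
  subUm : Set.Icc c b ⊆ Um
  fp : ℝ → ℝ
  fm : ℝ → ℝ
  fp_eq : Set.EqOn fp f (Set.Icc a c)
  fm_eq : Set.EqOn fm f (Set.Icc c b)
  fp_smooth : ContDiffOn ℝ r fp Up
  fm_smooth : ContDiffOn ℝ r fm Um
  κ : ℝ
  one_lt_κ : 1 < κ
  fp_exp : ∀ x ∈ Up, κ ≤ |deriv fp x|
  fm_exp : ∀ x ∈ Um, κ ≤ |deriv fm x|

namespace PWUnimodal

variable {r : ℕ}

/-- The (one-sided) derivative `f'` of a piecewise expanding unimodal map, defined via the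
two smooth extensions. -/
def d (F : PWUnimodal r) (x : ℝ) : ℝ := if x ≤ F.c then deriv F.fp x else deriv F.fm x

/-- `(f^n)'(x)`, the derivative of the `n`-th iterate. -/
def dn (F : PWUnimodal r) (n : ℕ) (x : ℝ) : ℝ :=
  ∏ i ∈ Finset.range n, F.d (F.f^[i] x)

/-- `c_k = f^k(c)`, the postcritical orbit. -/
def ck (F : PWUnimodal r) (k : ℕ) : ℝ := F.f^[k] F.c

/-- The critical point is periodic. -/
def CritPeriodic (F : PWUnimodal r) : Prop := ∃ n, 0 < n ∧ F.f^[n] F.c = F.c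

/-- `f` is good: either `c` is not periodic, or `inf |(f^{n₁})'| > 2` where `n₁` is the
minimal period of `c`. -/
def Good (F : PWUnimodal r) : Prop :=
  ¬ F.CritPeriodic ∨
    ∀ x ∈ Set.Icc F.a F.b, 2 < |F.dn (Function.minimalPeriod F.f F.c) x|

/-- `f` is topologically mixing on `[f²(c), f(c)]`. -/
def Mixing (F : PWUnimodal r) : Prop :=
  ∀ U V : Set ℝ, IsOpen U → IsOpen V →
    (U ∩ Set.Icc (F.ck 2) (F.ck 1)).Nonempty →
    (V ∩ Set.Icc (F.ck 2) (F.ck 1)).Nonempty →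
    ∃ N, ∀ n ≥ N, (F.f^[n] '' (U ∩ Set.Icc (F.ck 2) (F.ck 1)) ∩ V).Nonempty

/-- `v` is horizontal for `f`: `∑_{j=0}^{M_f-1} v(c_j)/(f^j)'(c_1) = 0`, where `M_f = n₁` if
`c` is periodic of minimal period `n₁` and `M_f = ∞` otherwise. -/
def Horizontal (F : PWUnimodal r) (v : ℝ → ℝ) : Prop :=
  (F.CritPeriodic →
    ∑ j ∈ Finset.range (Function.minimalPeriod F.f F.c), v (F.ck j) / F.dn j (F.ck 1) = 0) ∧
  (¬ F.CritPeriodic → ∑' j : ℕ, v (F.ck j) / F.dn j (F.ck 1) = 0)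

open scoped Classical in
/-- `N_f = n₀ + n₁ - 1` if `c` is preperiodic, `n₁` if `c` is periodic of minimal period `n₁`,
and `∞` otherwise. -/
def Nf (F : PWUnimodal r) : ℕ∞ :=
  if F.c ∈ Function.periodicPts F.f then (Function.minimalPeriod F.f F.c : ℕ∞)
  else if h : ∃ m, 0 < m ∧ F.f^[m] F.c ∈ Function.periodicPts F.f then
    ((Nat.find h + Function.minimalPeriod F.f (F.f^[Nat.find h] F.c) - 1 : ℕ) : ℕ∞)
  else ⊤

open scoped Classical in
/-- `M_f = n₁` if `c` is periodic of minimal period `n₁`, and `∞` otherwise. -/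
def Mf (F : PWUnimodal r) : ℕ∞ :=
  if F.c ∈ Function.periodicPts F.f then (Function.minimalPeriod F.f F.c : ℕ∞) else ⊤

/-- `ρ` is the (unique) absolutely continuous invariant probability density of `f`:
a nonnegative integrable function of bounded variation, supported in `[a,b]`, of total
integral one, whose associated measure is `f`-invariant. -/
structure IsInvDensity (F : PWUnimodal r) (ρ : ℝ → ℝ) : Prop where
  nonneg : ∀ x, 0 ≤ ρ x
  integrable : MeasureTheory.Integrable ρ
  mass : (∫ x, ρ x) = 1
  supp : Function.support ρ ⊆ Set.Icc F.a F.b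
  bv : BoundedVariationOn ρ Set.univ
  invariant : ∀ φ : ℝ → ℝ, Continuous φ → (∫ x, φ (F.f x) * ρ x) = ∫ x, φ x * ρ x

end PWUnimodal

/-- Sum of `g n` over `1 ≤ n ≤ N`, where `N ∈ ℕ∞`. -/
def sumTo (N : ℕ∞) (g : ℕ → ℝ) : ℝ :=
  ∑' n : ℕ, if 1 ≤ n ∧ (n : ℕ∞) ≤ N then g n else 0

/-- The jump function `H_u`: `-1` on `(-∞,u)`, `-1/2` at `u`, `0` on `(u,∞)`. -/
def Hfun (u x : ℝ) : ℝ := if x < u then -1 else if x = u then -(1/2) else 0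

namespace PWUnimodal

variable {r : ℕ}

/-- The saltus function `∑_{n=1}^{N_f} s_n H_{c_n}`. -/
def saltus (F : PWUnimodal r) (s : ℕ → ℝ) (x : ℝ) : ℝ :=
  sumTo F.Nf (fun n => s n * Hfun (F.ck n) x)

/-- The decomposition `ρ₀ = ρ_reg + ρ_sal` of the invariant density into a continuous part
and the saltus part `ρ_sal = ∑_{n=1}^{N_f} s_n H_{c_n}`. -/
structure SaltusDecomp (F : PWUnimodal r) (ρ₀ ρreg : ℝ → ℝ) (s : ℕ → ℝ) : Prop where
  cont : Continuous ρreg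
  eq : ∀ x, ρ₀ x = ρreg x + F.saltus s x

/-- The weighted total jump `J(f,X) = ∑_{n=1}^{N_f} s_n X(c_n)`. -/
def Jfun (F : PWUnimodal r) (s : ℕ → ℝ) (X : ℝ → ℝ) : ℝ :=
  sumTo F.Nf (fun n => s n * X (F.ck n))

open scoped Classical in
/-- The solution `α_{(0)}` (with `α(c) = 0`) of the twisted cohomological equation, given by
the explicit series/finite-sum formula. -/
def alpha0 (F : PWUnimodal r) (v : ℝ → ℝ) (x : ℝ) : ℝ :=
  if h : ∃ ℓ, 1 ≤ ℓ ∧ F.f^[ℓ] x = F.c then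
    -∑ j ∈ Finset.range (Nat.find h), v (F.f^[j] x) / F.dn (j+1) x
  else -∑' j : ℕ, v (F.f^[j] x) / F.dn (j+1) x

/-- `C^r` extensions `ψ₊, ψ₋` of the two inverse branches of `f` to `J = (-∞, f(c)]`,
with derivatives bounded in modulus by some `θ < 1`. -/
structure InvBranches (F : PWUnimodal r) where
  ψp : ℝ → ℝ
  ψm : ℝ → ℝ
  smooth_p : ContDiffOn ℝ r ψp (Set.Iic (F.f F.c))
  smooth_m : ContDiffOn ℝ r ψm (Set.Iic (F.f F.c))
  inv_p : ∀ y ∈ Set.Icc F.a (F.f F.c), ψp y ∈ Set.Icc F.a F.c ∧ F.f (ψp y) = y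
  inv_m : ∀ y ∈ Set.Icc F.a (F.f F.c), ψm y ∈ Set.Icc F.c F.b ∧ F.f (ψm y) = y
  θ : ℝ
  θ_lt : θ < 1
  dψp : ∀ y ∈ Set.Iic (F.f F.c), |deriv ψp y| ≤ θ
  dψm : ∀ y ∈ Set.Iic (F.f F.c), |deriv ψm y| ≤ θ

/-- `χ`: the indicator `1` on `(-∞, f(c))`, `1/2` at `f(c)`, `0` beyond. -/
def χ (F : PWUnimodal r) (x : ℝ) : ℝ :=
  if x < F.f F.c then 1 else if x = F.f F.c then 1/2 else 0

/-- The operator `L₀`. -/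
def InvBranches.L0 {F : PWUnimodal r} (B : F.InvBranches) (φ : ℝ → ℝ) (x : ℝ) : ℝ :=
  F.χ x * φ (B.ψp x) - F.χ x * φ (B.ψm x)

/-- The Perron-Frobenius transfer operator `L₁`. -/
def InvBranches.L1 {F : PWUnimodal r} (B : F.InvBranches) (φ : ℝ → ℝ) (x : ℝ) : ℝ :=
  F.χ x * (deriv B.ψp x * φ (B.ψp x)) + F.χ x * (|deriv B.ψm x| * φ (B.ψm x))

/-- The operator `L₀` on complex-valued functions. -/
def InvBranches.L0c {F : PWUnimodal r} (B : F.InvBranches) (φ : ℝ → ℂ) (x : ℝ) : ℂ :=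
  (F.χ x : ℂ) * φ (B.ψp x) - (F.χ x : ℂ) * φ (B.ψm x)

/-- The transfer operator `L₁` on complex-valued functions. -/
def InvBranches.L1c {F : PWUnimodal r} (B : F.InvBranches) (φ : ℝ → ℂ) (x : ℝ) : ℂ :=
  (F.χ x : ℂ) * (Complex.ofReal (deriv B.ψp x) * φ (B.ψp x)) +
    (F.χ x : ℂ) * (Complex.ofReal |deriv B.ψm x| * φ (B.ψm x))

/-- Forgetting smoothness: a piecewise expanding `C^r` unimodal map is also `C^{r'}` for
`r' ≤ r`. -/
def restrict (F : PWUnimodal r) (r' : ℕ) (h : r' ≤ r) : PWUnimodal r' :=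
  { F with
    fp_smooth := F.fp_smooth.of_le (by exact_mod_cast h)
    fm_smooth := F.fm_smooth.of_le (by exact_mod_cast h) }

end PWUnimodal

/-- A `C^{r₀,r}` perturbation `(f_t)_{|t|<ε}` of a piecewise expanding `C^r` unimodal map `F`:
a family of piecewise expanding `C^r` unimodal maps on the same interval with the same turning
point, with `f_0 = f`, uniformly bounded `C^r` norms of the one-sided extensions on fixed
neighbourhoods, `‖(f - f_t)|_{I_σ}‖_{C^{r-1}} = O(t)`, and such that `(x,t) ↦ f_t(x)` extends,
on each side, to a `C^{r₀}` function on a neighbourhood of `I_σ × {0}`. -/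
structure PWFamily (r₀ r : ℕ) (F : PWUnimodal r) (ε : ℝ) where
  εpos : 0 < ε
  fam : ℝ → PWUnimodal r
  same_a : ∀ t, (fam t).a = F.a
  same_b : ∀ t, (fam t).b = F.b
  same_c : ∀ t, (fam t).c = F.c
  at0 : fam 0 = F
  Vp : Set ℝ
  Vm : Set ℝ
  openVp : IsOpen Vp
  openVm : IsOpen Vm
  subVp : Set.Icc F.a F.c ⊆ Vp
  subVm : Set.Icc F.c F.b ⊆ Vm
  VpUp : ∀ t, |t| < ε → Vp ⊆ (fam t).Up
  VmUm : ∀ t, |t| < ε → Vm ⊆ (fam t).Um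
  Cb : ℝ
  unif_p : ∀ t, |t| < ε → ∀ i ≤ r, ∀ x ∈ Vp, |iteratedDeriv i (fam t).fp x| ≤ Cb
  unif_m : ∀ t, |t| < ε → ∀ i ≤ r, ∀ x ∈ Vm, |iteratedDeriv i (fam t).fm x| ≤ Cb
  close_p : ∀ t, |t| < ε → ∀ i ≤ r - 1, ∀ x ∈ Vp,
    |iteratedDeriv i (fun y => F.fp y - (fam t).fp y) x| ≤ Cb * |t|
  close_m : ∀ t, |t| < ε → ∀ i ≤ r - 1, ∀ x ∈ Vm,
    |iteratedDeriv i (fun y => F.fm y - (fam t).fm y) x| ≤ Cb * |t|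
  Gp : ℝ × ℝ → ℝ
  Gm : ℝ × ℝ → ℝ
  Wp : Set (ℝ × ℝ)
  Wm : Set (ℝ × ℝ)
  openWp : IsOpen Wp
  openWm : IsOpen Wm
  subWp : (Set.Icc F.a F.c) ×ˢ ({0} : Set ℝ) ⊆ Wp
  subWm : (Set.Icc F.c F.b) ×ˢ ({0} : Set ℝ) ⊆ Wm
  smoothGp : ContDiffOn ℝ r₀ Gp Wp
  smoothGm : ContDiffOn ℝ r₀ Gm Wm
  Gp_eq : ∀ t, |t| < ε → ∀ x ∈ Set.Icc F.a F.c, (x, t) ∈ Wp → Gp (x, t) = (fam t).f x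
  Gm_eq : ∀ t, |t| < ε → ∀ x ∈ Set.Icc F.c F.b, (x, t) ∈ Wm → Gm (x, t) = (fam t).f x

/-- The infinitesimal deformation `v = ∂_t f_t|_{t=0}`. -/
def PWFamily.v {r₀ r : ℕ} {F : PWUnimodal r} {ε : ℝ} (P : PWFamily r₀ r F ε) (x : ℝ) : ℝ :=
  if x ≤ F.c then deriv (fun t => P.Gp (x, t)) 0 else deriv (fun t => P.Gm (x, t)) 0

/-- A `C^{r₀,r}` perturbation staying in the topological class of `F`: each `f_t` is
conjugated to `f` by a homeomorphism `h_t` of `I` fixing `c`. -/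
structure ConjFamily (r₀ r : ℕ) (F : PWUnimodal r) (ε : ℝ) extends PWFamily r₀ r F ε where
  h : ℝ → ℝ → ℝ
  h_cont : ∀ t, |t| < ε → ContinuousOn (h t) (Set.Icc F.a F.b)
  h_bij : ∀ t, |t| < ε → Set.BijOn (h t) (Set.Icc F.a F.b) (Set.Icc F.a F.b)
  h_c : ∀ t, |t| < ε → h t F.c = F.c
  h_conj : ∀ t, |t| < ε → ∀ x ∈ Set.Icc F.a F.b, (fam t).f (h t x) = h t (F.f x)

/-- The infinitesimal conjugacy `α = ∂_t h_t|_{t=0}`. -/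
def ConjFamily.alpha {r₀ r : ℕ} {F : PWUnimodal r} {ε : ℝ} (C : ConjFamily r₀ r F ε)
    (x : ℝ) : ℝ :=
  deriv (fun t => C.h t x) 0

/-- A perturbation `P` is tangent to the topological class of `F` if there is a `C^{2,2}`
perturbation `f̃_t` of `F` lying in the topological class of `F` with
`sup_x |f̃_t(x) - f_t(x)| = O(t²)`. -/
structure PWFamily.TangentData {r₀ r : ℕ} {F : PWUnimodal r} {ε : ℝ}
    (P : PWFamily r₀ r F ε) (hr : 2 ≤ r) where
  Q : ConjFamily 2 2 (F.restrict 2 hr) ε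
  K : ℝ
  close : ∀ t, |t| < ε → ∀ x ∈ Set.Icc F.a F.b, |(Q.fam t).f x - (P.fam t).f x| ≤ K * t ^ 2

/-- An abstract realization of the Banach space `BV` of bounded variation functions supported
in `[a,b]`, modulo functions differing on an at most countable set, with the variation norm. -/
structure BVRealization (a b : ℝ) (V : Type) [NormedAddCommGroup V] [NormedSpace ℂ V] where
  toFun : V →ₗ[ℂ] (ℝ → ℂ)
  bv : ∀ φ, BoundedVariationOn (toFun φ) Set.univ
  supp : ∀ φ, Function.support (toFun φ) ⊆ Set.Icc a b
  zero_iff : ∀ φ : V, φ = 0 ↔ (Function.support (toFun φ)).Countable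
  surj : ∀ g : ℝ → ℂ, BoundedVariationOn g Set.univ → Function.support g ⊆ Set.Icc a b →
    ∃ φ : V, {x | toFun φ x ≠ g x}.Countable
  norm_eq : ∀ φ : V, ENNReal.ofReal ‖φ‖ =
    ⨅ g ∈ {g : ℝ → ℂ | {x | g x ≠ toFun φ x}.Countable}, eVariationOn g Set.univ

/-- An abstract realization of the Banach space `BV^{(1)}` of functions supported in
`(-∞, b]` whose (distributional) derivative is a function of bounded variation, with norm
`‖φ‖ = ‖φ'‖_{BV}`. -/
structure BV1Realization (a b : ℝ) (W : Type) [NormedAddCommGroup W] [NormedSpace ℂ W] where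
  toFun : W →ₗ[ℂ] (ℝ → ℂ)
  inj : ∀ φ : W, toFun φ = 0 → φ = 0
  deriv_bv : ∀ φ : W, ∃ g : ℝ → ℂ, BoundedVariationOn g Set.univ ∧
    Function.support g ⊆ Set.Icc a b ∧ ∀ x, toFun φ x = -∫ t in Set.Ioc x b, g t
  surj : ∀ g : ℝ → ℂ, BoundedVariationOn g Set.univ → Function.support g ⊆ Set.Icc a b →
    ∃ φ : W, ∀ x, toFun φ x = -∫ t in Set.Ioc x b, g t
  norm_eq : ∀ φ : W, ENNReal.ofReal ‖φ‖ =
    ⨅ g ∈ {g : ℝ → ℂ | ∀ x, toFun φ x = -∫ t in Set.Ioc x b, g t}, eVariationOn g Set.univ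


lemma bv_stieltjes (ρ : ℝ → ℝ) (h : BoundedVariationOn ρ univ) :
    ∃ (u v : StieltjesFunction ℝ) (C : ℝ) (E : Set ℝ), (∀ x, |u x| ≤ C) ∧ (∀ x, |v x| ≤ C) ∧
      E.Countable ∧ ∀ x ∉ E, ρ x = u x - v x ∧ ContinuousAt u x ∧ ContinuousAt v x := by
  have hl := h.locallyBoundedVariationOn
  set p : ℝ → ℝ := variationOnFromTo ρ univ 0 with hp
  have hpm : Monotone p := by
    have := variationOnFromTo.monotoneOn hl (mem_univ (0:ℝ))
    exact monotoneOn_univ.mp this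
  have hqm : Monotone (p - ρ) := by
    have := variationOnFromTo.sub_self_monotoneOn hl (mem_univ (0:ℝ))
    exact monotoneOn_univ.mp this
  set V := (eVariationOn ρ univ).toReal
  have hpb : ∀ x, |p x| ≤ V := by
    intro x
    have key : ∀ s : Set ℝ, (eVariationOn ρ s).toReal ≤ V := fun s =>
      ENNReal.toReal_mono h (eVariationOn.mono ρ (subset_univ s))
    simp only [hp, variationOnFromTo]
    split_ifs
    · rw [abs_of_nonneg ENNReal.toReal_nonneg]; exact key _
    · rw [abs_neg, abs_of_nonneg ENNReal.toReal_nonneg]; exact key _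
  have hρb : ∀ x, |ρ x| ≤ V + |ρ 0| := by
    intro x
    have := h.dist_le (mem_univ x) (mem_univ 0)
    rw [Real.dist_eq] at this
    have h2 := abs_sub_abs_le_abs_sub (ρ x) (ρ 0)
    linarith
  have rl : ∀ (g : ℝ → ℝ) (hg : Monotone g) (C : ℝ), (∀ x, |g x| ≤ C) →
      ∀ x, |hg.stieltjesFunction x| ≤ C := by
    intro g hg C hC x
    rw [hg.stieltjesFunction_eq]
    have h1 := hg.tendsto_rightLim x
    exact le_of_tendsto h1.abs (Eventually.of_forall fun y => hC y)
  refine ⟨hpm.stieltjesFunction, hqm.stieltjesFunction, V + (V + |ρ 0|),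
    {x | ¬ ContinuousAt p x} ∪ {x | ¬ ContinuousAt (p - ρ) x} ∪
    ({x | ¬ ContinuousAt hpm.stieltjesFunction x} ∪ {x | ¬ ContinuousAt hqm.stieltjesFunction x}),
    ?_, ?_, ?_, ?_⟩
  · apply rl
    intro x
    have := hpb x
    have : 0 ≤ V + |ρ 0| := (abs_nonneg _).trans (hρb 0)
    linarith
  · apply rl
    intro x
    have h1 := hpb x
    have h2 := hρb x
    have := abs_sub (p x) (ρ x)
    simp only [Pi.sub_apply]
    linarith
  · exact (hpm.countable_not_continuousAt.union hqm.countable_not_continuousAt).union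
      ((StieltjesFunction.mono _).countable_not_continuousAt.union
        (StieltjesFunction.mono _).countable_not_continuousAt)
  · intro x hx
    simp only [mem_union, mem_ofPred_eq, not_or, not_not] at hx
    refine ⟨?_, hx.2.1, hx.2.2⟩
    rw [hpm.stieltjesFunction_eq, hqm.stieltjesFunction_eq]
    rw [(hx.1.1.continuousWithinAt).rightLim_eq, (hx.1.2.continuousWithinAt).rightLim_eq]
    simp

/-- facts about a compactly supported continuous function with bounded derivative -/
lemma cpt_deriv (θ : ℝ → ℝ) (hc : Continuous θ) (A B K : ℝ) (h0 : ∀ x, x ≤ A ∨ B ≤ x → θ x = 0)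
    (S : Set ℝ) (hS : S.Countable)
    (hd : ∀ x ∉ S, DifferentiableAt ℝ θ x ∧ |deriv θ x| ≤ K) :
    Integrable (deriv θ) ∧ ∀ t, ∫ x in Ici t, deriv θ x = - θ t := by
  have hlow : ∀ x, x < A → deriv θ x = 0 := by
    intro x hx
    have : θ =ᶠ[𝓝 x] fun _ => 0 := by
      filter_upwards [Iio_mem_nhds hx] with y hy using h0 y (Or.inl (le_of_lt hy))
    rw [this.deriv_eq]; simp
  have hhigh : ∀ x, B < x → deriv θ x = 0 := by
    intro x hx
    have : θ =ᶠ[𝓝 x] fun _ => 0 := by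
      filter_upwards [Ioi_mem_nhds hx] with y hy using h0 y (Or.inr (le_of_lt hy))
    rw [this.deriv_eq]; simp
  have hInt : Integrable (deriv θ) := by
    refine Integrable.mono' (g := (Icc A B).indicator fun _ => K) ?_
      (measurable_deriv θ).aestronglyMeasurable ?_
    · exact (integrable_indicator_iff measurableSet_Icc).2 (by simp)
    · have : ∀ᵐ x : ℝ, x ∉ S := hS.ae_notMem _
      filter_upwards [this] with x hx
      by_cases hxx : x ∈ Icc A B
      · simp [hxx]; exact (hd x hx).2
      · simp only [hxx, not_false_eq_true, indicator_of_notMem, norm_le_zero_iff]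
        by_cases hA : x < A
        · exact hlow x hA
        · apply hhigh; by_contra hB; exact hxx ⟨not_lt.1 hA, not_lt.1 hB⟩
  refine ⟨hInt, fun t => ?_⟩
  rw [integral_Ici_eq_integral_Ioi]
  set T := max t B
  have hsplit : ∫ x in Ioi t, deriv θ x = (∫ x in Ioc t T, deriv θ x) + ∫ x in Ioi T, deriv θ x := by
    rw [← setIntegral_union Ioc_disjoint_Ioi_same measurableSet_Ioi hInt.integrableOn
      hInt.integrableOn, Ioc_union_Ioi_eq_Ioi (le_max_left _ _)]
  have hz : ∫ x in Ioi T, deriv θ x = 0 := by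
    rw [setIntegral_congr_fun (g := fun _ => (0:ℝ)) measurableSet_Ioi]
    · simp
    · intro x hx; exact hhigh x (lt_of_le_of_lt (le_max_right _ _) hx)
  rw [hsplit, hz, add_zero, ← intervalIntegral.integral_of_le (le_max_left _ _)]
  rw [integral_eq_of_hasDerivAt_off_countable_of_le θ (deriv θ) (le_max_left t B) hS hc.continuousOn
    (fun x hx => (hd x hx.2).1.hasDerivAt) hInt.intervalIntegrable]
  rw [h0 T (Or.inr (le_max_right _ _))]; ring

/-- Stieltjes integration by parts. -/
lemma stieltjes_parts (u : StieltjesFunction ℝ) (C : ℝ) (hu : ∀ x, |u x| ≤ C)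
    (θ : ℝ → ℝ) (hc : Continuous θ) (A B K : ℝ) (h0 : ∀ x, x ≤ A ∨ B ≤ x → θ x = 0)
    (S : Set ℝ) (hS : S.Countable)
    (hd : ∀ x ∉ S, DifferentiableAt ℝ θ x ∧ |deriv θ x| ≤ K) :
    Integrable (fun x => u x * deriv θ x) ∧ ∫ x, u x * deriv θ x = - ∫ x, θ x ∂u.measure := by
  haveI : IsFiniteMeasure u.measure := u.isFiniteMeasure_of_forall_abs_le hu
  obtain ⟨hInt, hI⟩ := cpt_deriv θ hc A B K h0 S hS hd
  have hmeas : Measurable u := u.mono.measurable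
  have hInt2 : Integrable (fun x => u x * deriv θ x) := by
    refine hInt.bdd_mul (c := C) hmeas.aestronglyMeasurable ?_
    exact Eventually.of_forall hu
  refine ⟨hInt2, ?_⟩
  obtain ⟨l, hl⟩ : ∃ l, Tendsto u atBot (𝓝 l) := by
    have := tendsto_atBot_ciInf u.mono ⟨-C, by rintro _ ⟨x, rfl⟩; exact (abs_le.1 (hu x)).1⟩
    exact ⟨_, this⟩
  have hzero : ∫ x, deriv θ x = 0 := by
    have h1 := hI A
    rw [h0 A (Or.inl le_rfl), neg_zero] at h1
    rw [← h1, ← integral_indicator measurableSet_Ici]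
    apply integral_congr_ae
    refine Eventually.of_forall fun x => ?_
    by_cases hx : x ∈ Ici A
    · simp [hx]
    · simp only [hx, not_false_eq_true, indicator_of_notMem]
      have : θ =ᶠ[𝓝 x] fun _ => 0 := by
        filter_upwards [Iio_mem_nhds (not_le.1 hx)] with y hy using h0 y (Or.inl (le_of_lt hy))
      rw [this.deriv_eq]; simp
  have hF : Integrable (fun z : ℝ × ℝ => (Ici z.1).indicator (deriv θ) z.2)
      (u.measure.prod volume) := by
    have hms : MeasurableSet {z : ℝ × ℝ | z.1 ≤ z.2} := measurableSet_le measurable_fst measurable_snd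
    have h1 : Integrable (fun z : ℝ × ℝ => deriv θ z.2) (u.measure.prod volume) :=
      hInt.comp_snd u.measure
    have h2 := h1.indicator hms
    refine h2.congr (Eventually.of_forall fun z => ?_)
    simp only [indicator, mem_ofPred_eq, mem_Ici]
  have hswap := integral_integral_swap (μ := u.measure) (ν := (volume : Measure ℝ))
    (f := fun t x => (Ici t).indicator (deriv θ) x) hF
  have hL : ∀ t, ∫ x, (Ici t).indicator (deriv θ) x = - θ t := by
    intro t; rw [integral_indicator measurableSet_Ici, hI]
  have hR : ∀ x, ∫ t, (Ici t).indicator (deriv θ) x ∂u.measure = (u x - l) * deriv θ x := by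
    intro x
    have : (fun t => (Ici t).indicator (deriv θ) x) = (Iic x).indicator fun _ => deriv θ x := by
      ext t; simp only [indicator, mem_Ici, mem_Iic]
    rw [this, integral_indicator measurableSet_Iic, setIntegral_const, smul_eq_mul,
      measureReal_def, u.measure_Iic hl, ENNReal.toReal_ofReal]
    have := u.mono.le_of_tendsto hl x
    linarith
  simp only [hL, hR] at hswap
  rw [integral_neg] at hswap
  rw [hswap]
  have : ∀ x, (u x - l) * deriv θ x = u x * deriv θ x - l * deriv θ x := fun x => by ring
  simp only [this]
  rw [integral_sub hInt2 (hInt.const_mul l), integral_const_mul, hzero]; ring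

/-- finite measures tested by smooth functions supported in an open set -/
lemma measure_ext_smooth (P Q : Measure ℝ) [IsFiniteMeasure P] [IsFiniteMeasure Q] (O : Set ℝ)
    (hO : IsOpen O)
    (h : ∀ ψ : ℝ → ℝ, ContDiff ℝ (⊤ : ℕ∞) ψ → HasCompactSupport ψ → tsupport ψ ⊆ O →
      ∫ x, ψ x ∂P = ∫ x, ψ x ∂Q) : P.restrict O = Q.restrict O := by
  set Z := P + Q
  have hP : P ≪ Z := Measure.absolutelyContinuous_of_le (Measure.le_add_right le_rfl)
  have hQ : Q ≪ Z := Measure.absolutelyContinuous_of_le (Measure.le_add_left le_rfl)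
  set p := fun x => (P.rnDeriv Z x).toReal
  set q := fun x => (Q.rnDeriv Z x).toReal
  have hp : Integrable p Z := Measure.integrable_toReal_rnDeriv
  have hq : Integrable q Z := Measure.integrable_toReal_rnDeriv
  have key : ∀ᵐ x ∂Z, x ∈ O → (p x - q x) = 0 := by
    apply hO.ae_eq_zero_of_integral_contDiff_smul_eq_zero
    · exact (hp.sub hq).locallyIntegrable.locallyIntegrableOn _
    · intro g hg hgc hgO
      have hb : ∃ C, ∀ x, ‖g x‖ ≤ C := hgc.exists_bound_of_continuous hg.continuous
      obtain ⟨C, hC⟩ := hb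
      have e1 : ∫ x, g x * p x ∂Z = ∫ x, g x ∂P := by
        rw [← integral_rnDeriv_smul hP]; simp only [p, smul_eq_mul, mul_comm]
      have e2 : ∫ x, g x * q x ∂Z = ∫ x, g x ∂Q := by
        rw [← integral_rnDeriv_smul hQ]; simp only [q, smul_eq_mul, mul_comm]
      simp only [smul_eq_mul, mul_sub]
      rw [integral_sub, e1, e2, h g hg hgc hgO, sub_self]
      · exact hp.bdd_mul hg.continuous.aestronglyMeasurable (Eventually.of_forall hC)
      · exact hq.bdd_mul hg.continuous.aestronglyMeasurable (Eventually.of_forall hC)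
  ext s hs
  rw [Measure.restrict_apply hs, Measure.restrict_apply hs,
    ← Measure.setLIntegral_rnDeriv hP, ← Measure.setLIntegral_rnDeriv hQ]
  apply setLIntegral_congr_fun_ae (hs.inter hO.measurableSet)
  filter_upwards [key, P.rnDeriv_lt_top Z, Q.rnDeriv_lt_top Z] with x hx h1 h2 hxs
  have := hx hxs.2
  exact (ENNReal.toReal_eq_toReal_iff' h1.ne h2.ne).1 (by simp only [p, q] at this; linarith)


lemma jumpfix_base (α β : ℝ) (hab : α < β) (w : ℝ → ℝ) (ε K : ℝ) (hε : 0 ≤ ε) (hK : 0 ≤ K)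
    (hw : ∀ x ∈ Ioo α β, DifferentiableAt ℝ w x ∧ |w x| ≤ ε ∧ |deriv w x| ≤ K) :
    ∃ C : ℝ, 0 ≤ C ∧ ∀ (φ : ℝ → ℝ) (B : ℝ), ContinuousOn φ (Icc α β) →
      (∀ x ∈ Icc α β, |φ x| ≤ B) →
      ∃ φ1 : ℝ → ℝ, ContinuousOn φ1 (Icc α β) ∧ φ1 α = 0 ∧ φ1 β = 0 ∧
        (∀ x ∈ Icc α β, |φ1 x| ≤ 2 * ε * B) ∧
        ∀ x ∈ Ioo α β, DifferentiableAt ℝ φ x →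
          DifferentiableAt ℝ φ1 x ∧ |w x * deriv φ x - deriv φ1 x| ≤ C * B := by
  have hlip : LipschitzOnWith ⟨K, hK⟩ w (Ioo α β) := by
    apply (convex_Ioo α β).lipschitzOnWith_of_nnnorm_deriv_le (fun x hx => (hw x hx).1)
    intro x hx
    exact (hw x hx).2.2
  obtain ⟨g, hg, hgw⟩ := hlip.extend_real
  have hgb : ∀ x ∈ Icc α β, |g x| ≤ ε := by
    intro x hx
    rw [← closure_Ioo hab.ne] at hx
    have hcl : IsClosed {x | |g x| ≤ ε} := isClosed_le hg.continuous.abs continuous_const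
    exact closure_minimal (fun y hy => by
      change |g y| ≤ ε
      rw [← hgw hy]; exact (hw y hy).2.1) hcl hx
  have hL : 0 < β - α := by linarith
  refine ⟨K + 2 * ε / (β - α), by positivity, ?_⟩
  intro φ B hφ hB
  have hB0 : 0 ≤ B := (abs_nonneg _).trans (hB α ⟨le_rfl, hab.le⟩)
  set P := g α * φ α with hP
  set Q := g β * φ β with hQ
  have hgφ : ∀ x ∈ Icc α β, |g x * φ x| ≤ ε * B := by
    intro x hx
    rw [abs_mul]; exact mul_le_mul (hgb x hx) (hB x hx) (abs_nonneg _) hε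
  have hPb : |P| ≤ ε * B := hgφ α ⟨le_rfl, hab.le⟩
  have hQb : |Q| ≤ ε * B := hgφ β ⟨hab.le, le_rfl⟩
  refine ⟨fun x => g x * φ x - (P + (x - α) * ((Q - P) / (β - α))), ?_, ?_, ?_, ?_, ?_⟩
  · apply (hg.continuous.continuousOn.mul hφ).sub
    fun_prop
  · simp [hP]
  · field_simp; ring
  · intro x hx
    have h1 := hgφ x hx
    have h2 : |P + (x - α) * ((Q - P) / (β - α))| ≤ ε * B := by
      have e : P + (x - α) * ((Q - P) / (β - α)) =
          ((β - x) / (β - α)) * P + ((x - α) / (β - α)) * Q := by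
        field_simp; ring
      have t1 : 0 ≤ (β - x) / (β - α) := div_nonneg (by linarith [hx.2]) hL.le
      have t2 : 0 ≤ (x - α) / (β - α) := div_nonneg (by linarith [hx.1]) hL.le
      have t3 : (β - x) / (β - α) + (x - α) / (β - α) = 1 := by field_simp; ring
      rw [e]
      refine (abs_add_le _ _).trans ?_
      rw [abs_mul _ P, abs_mul _ Q, abs_of_nonneg t1, abs_of_nonneg t2]
      calc _ ≤ (β - x) / (β - α) * (ε * B) + (x - α) / (β - α) * (ε * B) := by gcongr
        _ = ε * B := by rw [← add_mul, t3, one_mul]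
    have := abs_sub (g x * φ x) (P + (x - α) * ((Q - P) / (β - α)))
    linarith
  · intro x hx hd
    have hgd : HasDerivAt g (deriv w x) x := by
      have : g =ᶠ[𝓝 x] w := by
        filter_upwards [Ioo_mem_nhds hx.1 hx.2] with y hy using (hgw hy).symm
      exact (hw x hx).1.hasDerivAt.congr_of_eventuallyEq this
    have hlin : HasDerivAt (fun x => P + (x - α) * ((Q - P) / (β - α)))
        ((Q - P) / (β - α)) x := by
      simpa using (((hasDerivAt_id x).sub_const α).mul_const ((Q - P) / (β - α))).const_add P
    have hder := (hgd.mul hd.hasDerivAt).sub hlin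
    have hder' : HasDerivAt (fun x => g x * φ x - (P + (x - α) * ((Q - P) / (β - α)))) _ x := hder
    refine ⟨hder'.differentiableAt, ?_⟩
    rw [hder'.deriv, ← hgw hx]
    have e : w x * deriv φ x - (deriv w x * φ x + w x * deriv φ x - (Q - P) / (β - α)) =
      (Q - P) / (β - α) - deriv w x * φ x := by ring
    rw [e]
    have h1 : |(Q - P) / (β - α)| ≤ 2 * ε * B / (β - α) := by
      rw [abs_div, abs_of_pos hL]
      gcongr
      have := abs_sub Q P
      linarith
    have h2 : |deriv w x * φ x| ≤ K * B := by
      rw [abs_mul]; exact mul_le_mul (hw x hx).2.2 (hB x (Ioo_subset_Icc_self hx)) (abs_nonneg _) hK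
    have h3 := abs_sub ((Q - P) / (β - α)) (deriv w x * φ x)
    have e2 : (K + 2 * ε / (β - α)) * B = K * B + 2 * ε * B / (β - α) := by ring
    rw [e2]; linarith

lemma jumpfix (w : ℝ → ℝ) (ε K : ℝ) (hε : 0 ≤ ε) (hK : 0 ≤ K) (S : Finset ℝ) :
    ∀ (α β : ℝ), α < β →
    (∀ x ∈ Ioo α β, x ∉ S → DifferentiableAt ℝ w x ∧ |w x| ≤ ε ∧ |deriv w x| ≤ K) →
    ∃ C : ℝ, 0 ≤ C ∧ ∀ (φ : ℝ → ℝ) (B : ℝ), ContinuousOn φ (Icc α β) →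
      (∀ x ∈ Icc α β, |φ x| ≤ B) →
      ∃ φ1 : ℝ → ℝ, ContinuousOn φ1 (Icc α β) ∧ φ1 α = 0 ∧ φ1 β = 0 ∧
        (∀ x ∈ Icc α β, |φ1 x| ≤ 2 * ε * B) ∧
        ∀ x ∈ Ioo α β, x ∉ S → DifferentiableAt ℝ φ x →
          DifferentiableAt ℝ φ1 x ∧ |w x * deriv φ x - deriv φ1 x| ≤ C * B := by
  induction S using Finset.induction_on with
  | empty =>
    intro α β hab hw
    obtain ⟨C, hC, h⟩ := jumpfix_base α β hab w ε K hε hK (fun x hx => hw x hx (by simp))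
    refine ⟨C, hC, fun φ B h1 h2 => ?_⟩
    obtain ⟨φ1, a1, a2, a3, a4, a5⟩ := h φ B h1 h2
    exact ⟨φ1, a1, a2, a3, a4, fun x hx _ hd => a5 x hx hd⟩
  | insert s S hs ih =>
    intro α β hab hw
    by_cases hsI : s ∈ Ioo α β
    · obtain ⟨C1, hC1, H1⟩ := ih α s hsI.1 (fun x hx hxS => hw x ⟨hx.1, hx.2.trans hsI.2⟩ (by
        simp only [Finset.mem_insert, not_or]; exact ⟨hx.2.ne, hxS⟩))
      obtain ⟨C2, hC2, H2⟩ := ih s β hsI.2 (fun x hx hxS => hw x ⟨hsI.1.trans hx.1, hx.2⟩ (by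
        simp only [Finset.mem_insert, not_or]; exact ⟨hx.1.ne', hxS⟩))
      refine ⟨C1 + C2, by positivity, fun φ B h1 h2 => ?_⟩
      have hB0 : 0 ≤ B := (abs_nonneg _).trans (h2 α ⟨le_rfl, hab.le⟩)
      obtain ⟨p, a1, a2, a3, a4, a5⟩ := H1 φ B (h1.mono (Icc_subset_Icc le_rfl hsI.2.le))
        (fun x hx => h2 x ⟨hx.1, hx.2.trans hsI.2.le⟩)
      obtain ⟨q, b1, b2, b3, b4, b5⟩ := H2 φ B (h1.mono (Icc_subset_Icc hsI.1.le le_rfl))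
        (fun x hx => h2 x ⟨hsI.1.le.trans hx.1, hx.2⟩)
      refine ⟨fun x => if x ≤ s then p x else q x, ?_, ?_, ?_, ?_, ?_⟩
      · apply ContinuousOn.if'
        · rintro x ⟨hx, hxf⟩
          have hxs : x = s := by
            have : x ∈ frontier (Iic s) := hxf
            simpa using this
          subst hxs
          simp only [le_refl, if_true, a3]
          have := a1 x ⟨hsI.1.le, le_rfl⟩
          rw [ContinuousWithinAt, a3] at this
          exact this.mono_left (nhdsWithin_mono _ (fun y hy => ⟨hy.1.1, hy.2⟩))
        · rintro x ⟨hx, hxf⟩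
          have hxs : x = s := by
            have : x ∈ frontier (Iic s) := hxf
            simpa using this
          subst hxs
          simp only [le_refl, if_true, a3]
          have := b1 x ⟨le_rfl, hsI.2.le⟩
          rw [ContinuousWithinAt, b2] at this
          exact this.mono_left (nhdsWithin_mono _ (fun y hy => ⟨(not_le.1 hy.2).le, hy.1.2⟩))
        · exact a1.mono (fun y hy => ⟨hy.1.1, hy.2⟩)
        · exact b1.mono (fun y hy => ⟨(not_le.1 hy.2).le, hy.1.2⟩)
      · simp [hsI.1.le, a2]
      · simp [not_le.2 hsI.2, b3]
      · intro x hx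
        by_cases hxs : x ≤ s
        · simp only [hxs, if_true]; exact a4 x ⟨hx.1, hxs⟩
        · simp only [hxs, if_false]; exact b4 x ⟨(not_le.1 hxs).le, hx.2⟩
      · intro x hx hxS hd
        simp only [Finset.mem_insert, not_or] at hxS
        rcases lt_or_gt_of_ne hxS.1 with hlt | hgt
        · have he : (fun x => if x ≤ s then p x else q x) =ᶠ[𝓝 x] p := by
            filter_upwards [Iio_mem_nhds hlt] with y hy
            have : y ≤ s := le_of_lt hy
            simp [this]
          obtain ⟨c1, c2⟩ := a5 x ⟨hx.1, hlt⟩ hxS.2 hd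
          refine ⟨he.differentiableAt_iff.2 c1, ?_⟩
          rw [he.deriv_eq]
          nlinarith
        · have he : (fun x => if x ≤ s then p x else q x) =ᶠ[𝓝 x] q := by
            filter_upwards [Ioi_mem_nhds hgt] with y hy
            have : ¬ y ≤ s := not_le.2 hy
            simp [this]
          obtain ⟨c1, c2⟩ := b5 x ⟨hgt, hx.2⟩ hxS.2 hd
          refine ⟨he.differentiableAt_iff.2 c1, ?_⟩
          rw [he.deriv_eq]
          nlinarith
    · obtain ⟨C, hC, h⟩ := ih α β hab (fun x hx hxS => hw x hx (by
        simp only [Finset.mem_insert, not_or]; exact ⟨fun h => hsI (h ▸ hx), hxS⟩))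
      refine ⟨C, hC, fun φ B h1 h2 => ?_⟩
      obtain ⟨φ1, a1, a2, a3, a4, a5⟩ := h φ B h1 h2
      exact ⟨φ1, a1, a2, a3, a4, fun x hx hxS hd =>
        a5 x hx (fun h => hxS (Finset.mem_insert_of_mem h)) hd⟩


lemma riesz_int (G : ℝ → ℝ) (C : ℝ) (hC : 0 ≤ C) (hL : ∀ x, ∀ δ > 0, |G (x + δ) - G x| ≤ C * δ)
    (h : ∀ δ > 0, eVariationOn (fun x => (G (x + δ) - G x) / δ) univ ≤ ENNReal.ofReal C) :
    ∃ g : ℝ → ℝ, BoundedVariationOn g univ ∧ ∀ x y, x ≤ y → G y - G x = ∫ t in Ioc x y, g t := by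
  have hLip : LipschitzWith ⟨C, hC⟩ G := by
    apply LipschitzWith.of_dist_le_mul
    intro x y
    rw [Real.dist_eq, Real.dist_eq]
    change _ ≤ C * _
    rcases lt_trichotomy x y with hxy | hxy | hxy
    · have := hL x (y - x) (by linarith)
      rw [abs_sub_comm, abs_sub_comm x y, abs_of_pos (sub_pos.2 hxy)]
      simpa using this
    · subst hxy; simp
    · have := hL y (x - y) (by linarith)
      rw [abs_of_pos (sub_pos.2 hxy)]
      simpa using this
  set U : Ultrafilter ℕ := hyperfilter ℕ
  set δ : ℕ → ℝ := fun n => 1 / ((n : ℝ) + 1)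
  have hδ : ∀ n, 0 < δ n := fun n => by positivity
  set Δ : ℕ → ℝ → ℝ := fun n x => (G (x + δ n) - G x) / δ n
  have hΔ : ∀ n x, Δ n x ∈ Icc (-C) C := by
    intro n x
    rw [mem_Icc, ← abs_le]
    simp only [Δ]
    rw [abs_div, abs_of_pos (hδ n), div_le_iff₀ (hδ n)]
    exact hL x _ (hδ n)
  have hlim : ∀ x, ∃ l, Tendsto (fun n => Δ n x) U (𝓝 l) := by
    intro x
    obtain ⟨l, -, hl⟩ := (isCompact_Icc (a := -C) (b := C)).ultrafilter_le_nhds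
      (U.map (fun n => Δ n x)) (by
        simp only [le_principal_iff]
        exact Filter.mem_map.2 (Filter.univ_mem' (fun n => hΔ n x)))
    exact ⟨l, hl⟩
  choose g hg using hlim
  refine ⟨g, ?_, ?_⟩
  · intro htop
    have hlt : ENNReal.ofReal C < eVariationOn g univ := by rw [htop]; exact ENNReal.ofReal_lt_top
    have := eVariationOn.lowerSemicontinuous_aux (F := Δ) (p := (U : Filter ℕ)) (f := g) (s := univ)
      (fun x _ => hg x) hlt
    obtain ⟨n, hn⟩ := this.exists
    exact absurd (h (δ n) (hδ n)) (not_le.2 hn)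
  · intro x y hxy
    have hac : AbsolutelyContinuousOnInterval G x y :=
      (hLip.lipschitzOnWith (s := uIcc x y)).absolutelyContinuousOnInterval
    rw [← hac.integral_deriv_eq_sub, intervalIntegral.integral_of_le hxy]
    apply integral_congr_ae
    apply ae_restrict_of_ae
    filter_upwards [hLip.ae_differentiableAt] with t ht
    have h1 := ht.hasDerivAt.tendsto_slope
    have h2 : Tendsto (fun n => t + δ n) atTop (𝓝[≠] t) := by
      rw [tendsto_nhdsWithin_iff]
      refine ⟨?_, Eventually.of_forall fun n => ?_⟩
      · have := (tendsto_one_div_add_atTop_nhds_zero_nat (𝕜 := ℝ)).const_add t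
        simpa [δ] using this
      · have := hδ n
        simp only [mem_compl_iff, mem_singleton_iff]
        linarith
    have h3 : Tendsto (fun n => Δ n t) atTop (𝓝 (deriv G t)) := by
      have := h1.comp h2
      refine this.congr fun n => ?_
      simp [slope_def_field, Δ]
    have h4 : Tendsto (fun n => Δ n t) U (𝓝 (deriv G t)) :=
      h3.mono_left (by
        have := hyperfilter_le_cofinite (α := ℕ)
        rwa [Nat.cofinite_eq_atTop] at this)
    exact tendsto_nhds_unique h4 (hg t)

def ramp (δ x t : ℝ) : ℝ := max 0 (min 1 ((t - x) / δ))
def rampD (δ x t : ℝ) : ℝ := (Ioc x (x + δ)).indicator (fun _ => 1 / δ) t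

lemma ramp_cont (δ x : ℝ) : Continuous (ramp δ x) := by unfold ramp; fun_prop
lemma ramp_nonneg (δ x t : ℝ) : 0 ≤ ramp δ x t := le_max_left _ _
lemma ramp_le (δ x t : ℝ) : ramp δ x t ≤ 1 := max_le zero_le_one (min_le_left _ _)
lemma ramp_anti (δ : ℝ) (hδ : 0 < δ) (x y t : ℝ) (h : x ≤ y) : ramp δ y t ≤ ramp δ x t := by
  unfold ramp; gcongr
lemma ramp_deriv (δ : ℝ) (hδ : 0 < δ) (x t : ℝ) (h1 : t ≠ x) (h2 : t ≠ x + δ) :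
    HasDerivAt (ramp δ x) (rampD δ x t) t := by
  rcases lt_or_gt_of_ne h1 with h | h
  · have e : rampD δ x t = 0 := by
      unfold rampD; rw [indicator_of_notMem]; simp only [mem_Ioc, not_and]; intro; linarith
    rw [e]
    apply (hasDerivAt_const t (0:ℝ)).congr_of_eventuallyEq
    filter_upwards [Iio_mem_nhds h] with y hy
    have : (y - x) / δ ≤ 0 := div_nonpos_of_nonpos_of_nonneg (by linarith [mem_Iio.1 hy]) hδ.le
    unfold ramp
    exact max_eq_left ((min_le_right _ _).trans this)
  · rcases lt_or_gt_of_ne h2 with h' | h'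
    · have e : rampD δ x t = 1 / δ := by
        unfold rampD; rw [indicator_of_mem]; exact ⟨h, h'.le⟩
      rw [e]
      have : HasDerivAt (fun t => (t - x) / δ) (1 / δ) t :=
        ((hasDerivAt_id t).sub_const x).div_const δ
      apply this.congr_of_eventuallyEq
      filter_upwards [Ioo_mem_nhds h h'] with y hy
      unfold ramp
      have a1 : 0 ≤ (y - x) / δ := div_nonneg (by linarith [hy.1]) hδ.le
      have a2 : (y - x) / δ ≤ 1 := by rw [div_le_one hδ]; linarith [hy.2]
      rw [min_eq_right a2, max_eq_right a1]
    · have e : rampD δ x t = 0 := by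
        unfold rampD; rw [indicator_of_notMem]; simp only [mem_Ioc, not_and]; intro; linarith
      rw [e]
      apply (hasDerivAt_const t (1:ℝ)).congr_of_eventuallyEq
      filter_upwards [Ioi_mem_nhds h'] with y hy
      have : 1 ≤ (y - x) / δ := by rw [le_div_iff₀ hδ]; linarith [mem_Ioi.1 hy]
      unfold ramp
      rw [min_eq_left this]; simp

lemma rampD_int (ν : Measure ℝ) [IsFiniteMeasure ν] (δ : ℝ) (hδ : 0 < δ) (x : ℝ) :
    Integrable (rampD δ x) ν ∧
    ∫ t, rampD δ x t ∂ν = (ν.real (Iic (x + δ)) - ν.real (Iic x)) / δ := by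
  constructor
  · exact (integrable_const (1/δ)).indicator measurableSet_Ioc
  · unfold rampD
    rw [integral_indicator measurableSet_Ioc, setIntegral_const, smul_eq_mul]
    have : Ioc x (x + δ) = Iic (x + δ) \ Iic x := by
      ext; simp [and_comm]
    rw [this, measureReal_sdiff (Iic_subset_Iic.2 (by linarith)) measurableSet_Iic]
    ring

lemma rampD_abs (δ : ℝ) (hδ : 0 < δ) (x t : ℝ) : |rampD δ x t| ≤ 1 / δ := by
  unfold rampD
  have : 0 ≤ 1 / δ := by positivity
  by_cases h : t ∈ Ioc x (x + δ)
  · simp only [h, indicator_of_mem]; rw [abs_of_nonneg this]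
  · simp only [h, not_false_eq_true, indicator_of_notMem, abs_zero]; exact this

lemma riesz_dual (ν1 ν2 : Measure ℝ) [IsFiniteMeasure ν1] [IsFiniteMeasure ν2] [NullSingletonClass ν1]
    [NullSingletonClass ν2] (C : ℝ) (hC : 0 ≤ C)
    (h : ∀ (φ : ℝ → ℝ) (B Λ : ℝ) (T : Finset ℝ), Continuous φ → (∀ x, |φ x| ≤ B) →
      (∀ x ∉ T, DifferentiableAt ℝ φ x ∧ |deriv φ x| ≤ Λ) →
      |∫ x, deriv φ x ∂ν1 - ∫ x, deriv φ x ∂ν2| ≤ C * B) :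
    ∃ g : ℝ → ℝ, BoundedVariationOn g univ ∧ ∀ x y, x ≤ y →
      (ν1.real (Iic y) - ν2.real (Iic y)) - (ν1.real (Iic x) - ν2.real (Iic x)) =
        ∫ t in Ioc x y, g t := by
  set G : ℝ → ℝ := fun x => ν1.real (Iic x) - ν2.real (Iic x) with hG
  have hΔ : ∀ δ > 0, ∀ x, ∫ t, rampD δ x t ∂ν1 - ∫ t, rampD δ x t ∂ν2 = (G (x + δ) - G x) / δ := by
    intro δ hδ x
    rw [(rampD_int ν1 δ hδ x).2, (rampD_int ν2 δ hδ x).2]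
    simp only [hG]; ring
  have key : ∀ δ > 0, ∀ (n : ℕ) (u ε : ℕ → ℝ), Monotone u → (∀ i, |ε i| ≤ 1) →
      |∑ i ∈ Finset.range n, ε i * ((G (u i + δ) - G (u i)) / δ
        - (G (u (i+1) + δ) - G (u (i+1))) / δ)| ≤ C := by
    intro δ hδ n u ε hu hε
    set φ : ℝ → ℝ := fun t => ∑ i ∈ Finset.range n, ε i * (ramp δ (u i) t - ramp δ (u (i+1)) t)
    set ψ : ℝ → ℝ := fun t => ∑ i ∈ Finset.range n, ε i * (rampD δ (u i) t - rampD δ (u (i+1)) t)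
      with hψ
    set T : Finset ℝ := (Finset.range (n+1)).image u ∪ (Finset.range (n+1)).image (fun i => u i + δ)
    have hder : ∀ t ∉ T, HasDerivAt φ (ψ t) t := by
      intro t ht
      have ht' : ∀ i < n + 1, t ≠ u i ∧ t ≠ u i + δ := by
        intro i hi
        constructor
        · rintro rfl; exact ht (Finset.mem_union_left _ (Finset.mem_image_of_mem u (by simpa using hi)))
        · intro e; apply ht; rw [e]
          exact Finset.mem_union_right _
            (Finset.mem_image_of_mem (fun i => u i + δ) (by simpa using hi))
      apply HasDerivAt.fun_sum
      intro i hi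
      rw [Finset.mem_range] at hi
      apply HasDerivAt.const_mul
      exact (ramp_deriv δ hδ _ t (ht' i (by omega)).1 (ht' i (by omega)).2).sub
        (ramp_deriv δ hδ _ t (ht' (i+1) (by omega)).1 (ht' (i+1) (by omega)).2)
    have hφc : Continuous φ := by
      apply continuous_finsetSum
      intro i _
      exact continuous_const.mul ((ramp_cont _ _).sub (ramp_cont _ _))
    have hφb : ∀ t, |φ t| ≤ 1 := by
      intro t
      calc |φ t| ≤ ∑ i ∈ Finset.range n, |ε i * (ramp δ (u i) t - ramp δ (u (i+1)) t)| :=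
            Finset.abs_sum_le_sum_abs _ _
        _ ≤ ∑ i ∈ Finset.range n, (ramp δ (u i) t - ramp δ (u (i+1)) t) := by
            apply Finset.sum_le_sum
            intro i _
            have a := ramp_anti δ hδ (u i) (u (i+1)) t (hu (Nat.le_succ i))
            rw [abs_mul, abs_of_nonneg (sub_nonneg.2 a)]
            have := hε i
            nlinarith [sub_nonneg.2 a]
        _ = ramp δ (u 0) t - ramp δ (u n) t := by
            rw [Finset.sum_range_sub' (fun i => ramp δ (u i) t)]
        _ ≤ 1 := by linarith [ramp_le δ (u 0) t, ramp_nonneg δ (u n) t]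
    have hψb : ∀ t, |ψ t| ≤ n * (2 / δ) := by
      intro t
      calc |ψ t| ≤ ∑ i ∈ Finset.range n, |ε i * (rampD δ (u i) t - rampD δ (u (i+1)) t)| :=
            Finset.abs_sum_le_sum_abs _ _
        _ ≤ ∑ i ∈ Finset.range n, (2 / δ) := by
            apply Finset.sum_le_sum
            intro i _
            rw [abs_mul]
            have a1 := rampD_abs δ hδ (u i) t
            have a2 := rampD_abs δ hδ (u (i+1)) t
            have a3 := abs_sub (rampD δ (u i) t) (rampD δ (u (i+1)) t)
            have a4 : |rampD δ (u i) t - rampD δ (u (i+1)) t| ≤ 2 / δ := by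
              have : 2 / δ = 1/δ + 1/δ := by ring
              linarith
            have := hε i
            nlinarith [abs_nonneg (rampD δ (u i) t - rampD δ (u (i+1)) t), abs_nonneg (ε i)]
        _ = n * (2 / δ) := by simp
    have hmain := h φ 1 (n * (2 / δ)) T hφc hφb (fun x hx => ⟨(hder x hx).differentiableAt, by
      rw [(hder x hx).deriv]; exact hψb x⟩)
    have hae : ∀ (ν : Measure ℝ) [NullSingletonClass ν], ∫ x, deriv φ x ∂ν = ∫ x, ψ x ∂ν := by
      intro ν _
      apply integral_congr_ae
      filter_upwards [T.finite_toSet.countable.ae_notMem ν] with x hx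
      exact (hder x (by simpa using hx)).deriv
    have hsum : ∀ (ν : Measure ℝ) [IsFiniteMeasure ν], ∫ x, ψ x ∂ν =
        ∑ i ∈ Finset.range n, ε i * (∫ x, rampD δ (u i) x ∂ν - ∫ x, rampD δ (u (i+1)) x ∂ν) := by
      intro ν _
      simp only [hψ]
      rw [integral_finsetSum]
      · apply Finset.sum_congr rfl
        intro i _
        rw [integral_const_mul, integral_sub (rampD_int ν δ hδ _).1 (rampD_int ν δ hδ _).1]
      · intro i _
        exact ((rampD_int ν δ hδ _).1.sub (rampD_int ν δ hδ _).1).const_mul _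
    rw [hae ν1, hae ν2, hsum ν1, hsum ν2, ← Finset.sum_sub_distrib, mul_one] at hmain
    convert hmain using 3 with i hi
    rw [← hΔ δ hδ, ← hΔ δ hδ]; ring
  apply riesz_int G C hC
  · intro x δ hδ
    have h1 := h (ramp δ x) 1 (1/δ) {x, x+δ} (ramp_cont _ _)
      (fun t => by rw [abs_of_nonneg (ramp_nonneg _ _ _)]; exact ramp_le _ _ _)
      (fun t ht => by
        simp only [Finset.mem_insert, Finset.mem_singleton, not_or] at ht
        have := ramp_deriv δ hδ x t ht.1 ht.2
        exact ⟨this.differentiableAt, by rw [this.deriv]; exact rampD_abs δ hδ x t⟩)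
    have hae : ∀ (ν : Measure ℝ) [NullSingletonClass ν], ∫ t, deriv (ramp δ x) t ∂ν = ∫ t, rampD δ x t ∂ν := by
      intro ν _
      apply integral_congr_ae
      filter_upwards [(({x, x+δ} : Finset ℝ).finite_toSet.countable.ae_notMem ν)] with t ht
      simp only [Finset.coe_insert, Finset.coe_singleton, mem_insert_iff, mem_singleton_iff,
        not_or] at ht
      exact (ramp_deriv δ hδ x t ht.1 ht.2).deriv
    rw [hae ν1, hae ν2, hΔ δ hδ, abs_div, abs_of_pos hδ, div_le_iff₀ hδ] at h1
    linarith
  · intro δ hδ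
    apply iSup_le
    rintro ⟨n, u, hu, -⟩
    simp only
    set D : ℝ → ℝ := fun x => (G (x + δ) - G x) / δ with hD
    have hk := key δ hδ n u (fun i => if D (u i) - D (u (i+1)) ≥ 0 then 1 else -1) hu
      (fun i => by split_ifs <;> simp)
    have e : ∀ i, edist (D (u (i+1))) (D (u i)) = ENNReal.ofReal |D (u i) - D (u (i+1))| := by
      intro i; rw [edist_comm, edist_dist, Real.dist_eq]
    change ∑ i ∈ Finset.range n, edist (D (u (i+1))) (D (u i)) ≤ _
    simp only [e]
    rw [← ENNReal.ofReal_sum_of_nonneg (fun i _ => abs_nonneg _)]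
    apply ENNReal.ofReal_le_ofReal
    refine le_trans (le_of_eq ?_) ((le_abs_self _).trans hk)
    apply Finset.sum_congr rfl
    intro i _
    change |D (u i) - D (u (i+1))| = _ * (D (u i) - D (u (i+1)))
    split_ifs with hs
    · rw [abs_of_nonneg hs, one_mul]
    · rw [abs_of_neg (not_le.1 hs)]; ring


lemma atomic_const (W : ℝ → ℝ) (hW : Continuous W) (β1 β2 : Measure ℝ) [IsFiniteMeasure β1]
    [IsFiniteMeasure β2] (A E V : Set ℝ) (hA : A.Countable) (hE : E.Countable)
    (h1 : β1 Aᶜ = 0) (h2 : β2 Aᶜ = 0) (hV : IsOpen V) (hVc : V.OrdConnected)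
    (h : ∀ x ∈ V, ∀ y ∈ V, x < y → x ∉ E → y ∉ E →
      W y - W x = β1.real (Ioc x y) - β2.real (Ioc x y)) :
    ∀ x ∈ V, ∀ y ∈ V, W x = W y := by
  have hd : Dense (Eᶜ) := hE.dense_compl ℝ
  have hatom : ∀ z ∈ V, β1 {z} = β2 {z} := by
    intro z hz
    obtain ⟨xs, hxm, hxs, hxt⟩ := hd.exists_seq_strictMono_tendsto z
    obtain ⟨ys, hym, hys, hyt⟩ := hd.exists_seq_strictAnti_tendsto z
    have hI : ⋂ n, Ioc (xs n) (ys n) = {z} := by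
      ext t
      simp only [mem_iInter, mem_Ioc, mem_singleton_iff]
      constructor
      · intro ht
        apply le_antisymm
        · exact ge_of_tendsto' hyt (fun n => (ht n).2)
        · exact le_of_tendsto' hxt (fun n => (ht n).1.le)
      · rintro rfl n
        exact ⟨(hxs n).1, (hys n).1.le⟩
    have hlim : ∀ (β : Measure ℝ) [IsFiniteMeasure β],
        Tendsto (fun n => β.real (Ioc (xs n) (ys n))) atTop (𝓝 (β.real {z})) := by
      intro β _
      rw [← hI]
      refine (ENNReal.tendsto_toReal (measure_ne_top _ _)).comp
        (tendsto_measure_iInter_atTop (fun n => measurableSet_Ioc.nullMeasurableSet) ?_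
          ⟨0, measure_ne_top _ _⟩)
      intro m n hmn
      exact Ioc_subset_Ioc (hxm.monotone hmn) (hym.antitone hmn)
    have e1 : Tendsto (fun n => W (ys n) - W (xs n)) atTop (𝓝 (W z - W z)) :=
      ((hW.tendsto z).comp hyt).sub ((hW.tendsto z).comp hxt)
    have e2 := (hlim β1).sub (hlim β2)
    have e3 : (fun n => W (ys n) - W (xs n)) =ᶠ[atTop]
        fun n => β1.real (Ioc (xs n) (ys n)) - β2.real (Ioc (xs n) (ys n)) := by
      filter_upwards [hxt.eventually (hV.mem_nhds hz), hyt.eventually (hV.mem_nhds hz)] with n a b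
      exact h _ a _ b ((hxs n).1.trans (hys n).1) (hxs n).2 (hys n).2
    have e4 := tendsto_nhds_unique (e1.congr' e3) e2
    have : β1.real {z} = β2.real {z} := by linarith
    rwa [Measure.real, Measure.real, ENNReal.toReal_eq_toReal_iff' (measure_ne_top _ _)
      (measure_ne_top _ _)] at this
  have hms : ∀ (β : Measure ℝ), β Aᶜ = 0 → ∀ S : Set ℝ, β S = ∑' p : ↥(S ∩ A), β {(p:ℝ)} := by
    intro β hβ S
    have hc : (S ∩ A).Countable := hA.mono inter_subset_right
    have hb := measure_biUnion (μ := β) (f := fun p : ℝ => ({p} : Set ℝ)) hc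
      (fun i _ j _ hij => by simpa [Function.onFun] using hij)
      (fun _ _ => measurableSet_singleton _)
    rw [← hb, biUnion_of_singleton]
    apply le_antisymm _ (measure_mono inter_subset_left)
    calc β S ≤ β ((S ∩ A) ∪ Aᶜ) := measure_mono (by intro x hx; by_cases hxA : x ∈ A <;> simp [*])
      _ ≤ β (S ∩ A) + β Aᶜ := measure_union_le _ _
      _ = _ := by rw [hβ, add_zero]
  have hVE : ∀ x ∈ V, ∀ y ∈ V, x < y → x ∉ E → y ∉ E → W x = W y := by
    intro x hx y hy hxy hxE hyE
    have := h x hx y hy hxy hxE hyE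
    have e : β1 (Ioc x y) = β2 (Ioc x y) := by
      rw [hms β1 h1, hms β2 h2]
      apply tsum_congr
      rintro ⟨p, hp, -⟩
      exact hatom p (hVc.out hx hy ⟨hp.1.le, hp.2⟩)
    rw [Measure.real, Measure.real, e] at this
    linarith
  have hVE' : ∀ x ∈ V ∩ Eᶜ, ∀ y ∈ V ∩ Eᶜ, W x = W y := by
    rintro x ⟨hx, hxE⟩ y ⟨hy, hyE⟩
    rcases lt_trichotomy x y with hxy | hxy | hxy
    · exact hVE x hx y hy hxy hxE hyE
    · rw [hxy]
    · exact (hVE y hy x hx hxy hyE hxE).symm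
  have hcl : V ⊆ closure (V ∩ Eᶜ) := hd.open_subset_closure_inter hV
  have step : ∀ x ∈ V ∩ Eᶜ, ∀ y ∈ V, W x = W y := by
    intro x hx y hy
    have hcl2 : IsClosed {z | W x = W z} := isClosed_eq continuous_const hW
    exact closure_minimal (fun z hz => hVE' x hx z hz) hcl2 (hcl hy)
  intro x hx y hy
  have hne : (V ∩ Eᶜ).Nonempty := by
    rw [← closure_nonempty_iff]; exact ⟨x, hcl hx⟩
  obtain ⟨w, hw⟩ := hne
  rw [← step w hw x hx, ← step w hw y hy]

def Hf (u x : ℝ) : ℝ := if x < u then -1 else if x = u then -(1/2) else 0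

lemma Hf_diff (p x y : ℝ) (hxy : x < y) (hx : x ≠ p) (hy : y ≠ p) :
    Hf p y - Hf p x = (Ioc x y).indicator (fun _ => (1:ℝ)) p := by
  unfold Hf
  by_cases h1 : x < p
  · by_cases h2 : y < p
    · rw [indicator_of_notMem (by simp only [mem_Ioc, not_and, not_le]; intro; exact h2)]
      simp [h1, h2]
    · rw [indicator_of_mem (by exact ⟨h1, not_lt.1 h2⟩)]
      simp [h1, h2, hy]
  · have h2 : ¬ y < p := by push Not at *; linarith
    rw [indicator_of_notMem (by simp only [mem_Ioc, not_and, not_le]; intro h; exact absurd h h1)]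
    simp [h1, h2, hx, hy]

def diracs (τ p : ℕ → ℝ) : Measure ℝ := Measure.sum (fun n => ENNReal.ofReal (τ n) • Measure.dirac (p n))

lemma diracs_fin (τ p : ℕ → ℝ) (h : Summable fun n => max (τ n) 0) : IsFiniteMeasure (diracs τ p) := by
  constructor
  unfold diracs
  rw [Measure.sum_apply _ MeasurableSet.univ]
  simp only [Measure.smul_apply, measure_univ, smul_eq_mul, mul_one]
  have : ∀ n, ENNReal.ofReal (τ n) = ENNReal.ofReal (max (τ n) 0) := by
    intro n; rw [ENNReal.ofReal_max]; simp
  simp only [this]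
  rw [← ENNReal.ofReal_tsum_of_nonneg (fun n => le_max_right _ _) h]
  exact ENNReal.ofReal_lt_top

lemma diracs_null (τ p : ℕ → ℝ) (A : Set ℝ) (hA : MeasurableSet A) (h : ∀ n, p n ∈ A) : diracs τ p Aᶜ = 0 := by
  unfold diracs
  rw [Measure.sum_apply _ hA.compl]
  simp [h]

lemma diracs_real (τ p : ℕ → ℝ) (S : Set ℝ) (hS : MeasurableSet S) :
    (diracs τ p).real S = ∑' n, max (τ n) 0 * S.indicator (fun _ => (1:ℝ)) (p n) := by
  unfold diracs
  rw [Measure.real, Measure.sum_apply _ hS, ENNReal.tsum_toReal_eq]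
  · apply tsum_congr; intro n
    simp only [Measure.smul_apply, smul_eq_mul, ENNReal.toReal_mul, ENNReal.toReal_ofReal']
    rw [Measure.dirac_apply' _ hS]
    by_cases h : p n ∈ S <;> simp [h]
  · intro n
    simp only [Measure.smul_apply, smul_eq_mul]
    exact ENNReal.mul_ne_top ENNReal.ofReal_ne_top (measure_ne_top _ _)

lemma stieltjes_real (u : StieltjesFunction ℝ) (x y : ℝ) (h : x ≤ y) :
    u.measure.real (Ioc x y) = u y - u x := by
  rw [Measure.real, u.measure_Ioc, ENNReal.toReal_ofReal]
  have := u.mono h; linarith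

lemma lemJ1 (u1 u2 : StieltjesFunction ℝ) [IsFiniteMeasure u1.measure] [IsFiniteMeasure u2.measure]
    (E : Set ℝ) (hE : E.Countable) (ρ ρr : ℝ → ℝ) (hρ : ∀ x ∉ E, ρ x = u1 x - u2 x)
    (G : ℝ → ℝ) (hG : ∀ x y, x ≤ y → G y - G x = (u1.measure.restrict Eᶜ).real (Ioc x y) -
      (u2.measure.restrict Eᶜ).real (Ioc x y)) (hW : Continuous (fun x => ρr x - G x))
    (p τ : ℕ → ℝ) (hτ : Summable τ) (V : Set ℝ) (hV : IsOpen V) (hVc : V.OrdConnected)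
    (h : ∀ x ∈ V, ρr x = ρ x - ∑' n, τ n * Hf (p n) x) :
    ∀ x ∈ V, ∀ y ∈ V, ρr x - G x = ρr y - G y := by
  have hτp : Summable fun n => max (τ n) 0 := 
    Summable.of_nonneg_of_le (fun n => le_max_right _ _) (fun n => max_le (le_abs_self _) (abs_nonneg _)) hτ.abs
  have hτm : Summable fun n => max (-τ n) 0 := 
    Summable.of_nonneg_of_le (fun n => le_max_right _ _) (fun n => max_le (neg_le_abs _) (abs_nonneg _)) hτ.abs
  have := diracs_fin τ p hτp
  have := diracs_fin (fun n => -τ n) p hτm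
  have hR : (range p).Countable := countable_range p
  have hA : (E ∪ range p).Countable := hE.union hR
  apply atomic_const (fun x => ρr x - G x) hW (u1.measure.restrict E + diracs (fun n => -τ n) p) 
    (u2.measure.restrict E + diracs τ p) (E ∪ range p) (E ∪ range p) V hA hA ?_ ?_ hV hVc
  · intro x hx y hy hxy hxE hyE
    simp only [mem_union, mem_range, not_or, not_exists] at hxE hyE
    have hsum : ∀ x, Summable fun n => τ n * Hf (p n) x := by
      intro x
      apply Summable.of_abs
      apply Summable.of_nonneg_of_le (fun n => abs_nonneg _) _ hτ.abs
      intro n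
      rw [abs_mul]
      have : |Hf (p n) x| ≤ 1 := by unfold Hf; split_ifs <;> norm_num [abs_le]
      nlinarith [abs_nonneg (τ n)]
    have hs : ∀ σ : ℕ → ℝ, Summable (fun n => max (σ n) 0) →
        Summable (fun n => max (σ n) 0 * (Ioc x y).indicator (fun _ => (1:ℝ)) (p n)) := by
      intro σ hσ
      apply Summable.of_nonneg_of_le _ _ hσ
      · intro n; apply mul_nonneg (le_max_right _ _); exact indicator_nonneg (fun _ _ => zero_le_one) _
      · intro n
        have : (Ioc x y).indicator (fun _ => (1:ℝ)) (p n) ≤ 1 := by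
          by_cases hp : p n ∈ Ioc x y <;> simp [hp]
        nlinarith [le_max_right (σ n) 0]
    have e1 : (∑' n, τ n * Hf (p n) y) - ∑' n, τ n * Hf (p n) x =
        (diracs τ p).real (Ioc x y) - (diracs (fun n => -τ n) p).real (Ioc x y) := by
      rw [diracs_real _ _ _ measurableSet_Ioc, diracs_real _ _ _ measurableSet_Ioc,
        ← (hsum y).tsum_sub (hsum x), ← (hs τ hτp).tsum_sub (hs (fun n => -τ n) hτm)]
      apply tsum_congr; intro n
      rw [← mul_sub, Hf_diff _ _ _ hxy (fun e => hxE.2 n e.symm) (fun e => hyE.2 n e.symm), ← sub_mul]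
      congr 1
      rcases le_total (τ n) 0 with h | h
      · rw [max_eq_right h, max_eq_left (by linarith)]; ring
      · rw [max_eq_left h, max_eq_right (by linarith)]; ring
    have e2 : ∀ u : StieltjesFunction ℝ, IsFiniteMeasure u.measure → u y - u x = (u.measure.restrict E).real (Ioc x y) +
        (u.measure.restrict Eᶜ).real (Ioc x y) := by
      intro u _
      rw [← stieltjes_real u x y hxy.le, ← measureReal_add_apply, Measure.restrict_add_restrict_compl hE.measurableSet]
    have e3 := e2 u1 inferInstance
    have e4 := e2 u2 inferInstance
    have e5 := hG x y hxy.le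
    rw [measureReal_add_apply, measureReal_add_apply, h x hx, h y hy, hρ x hxE.1, hρ y hyE.1]
    linarith
  · simp only [Measure.coe_add, Pi.add_apply, add_eq_zero]
    refine ⟨?_, diracs_null _ _ _ hA.measurableSet (fun n => Or.inr ⟨n, rfl⟩)⟩
    rw [Measure.restrict_apply hA.measurableSet.compl]
    convert measure_empty (μ := u1.measure)
    ext x; simp; tauto
  · simp only [Measure.coe_add, Pi.add_apply, add_eq_zero]
    refine ⟨?_, diracs_null _ _ _ hA.measurableSet (fun n => Or.inr ⟨n, rfl⟩)⟩
    rw [Measure.restrict_apply hA.measurableSet.compl]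
    convert measure_empty (μ := u2.measure)
    ext x; simp; tauto

lemma lemJ (u1 u2 : StieltjesFunction ℝ) [IsFiniteMeasure u1.measure] [IsFiniteMeasure u2.measure]
    (E : Set ℝ) (hE : E.Countable) (ρ ρr : ℝ → ℝ) (hρ : ∀ x ∉ E, ρ x = u1 x - u2 x)
    (G : ℝ → ℝ) (hG : ∀ x y, x ≤ y → G y - G x = (u1.measure.restrict Eᶜ).real (Ioc x y) -
      (u2.measure.restrict Eᶜ).real (Ioc x y)) (hW : Continuous (fun x => ρr x - G x))
    (p τ : ℕ → ℝ) 
    (h : ∀ x, ρr x = ρ x - ∑' n, τ n * Hf (p n) x) :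
    ∀ x y, ρr x - G x = ρr y - G y := by
  set S : Set ℝ := {x | Summable fun n => τ n * Hf (p n) x}
  have hanti : ∀ p x y, x ≤ y → |Hf p y| ≤ |Hf p x| := by
    intro p x y hxy
    unfold Hf
    split_ifs <;> first | (exfalso; rename_i h1 h2 h3; first | linarith | exact h3 (by linarith)) | (exfalso; rename_i h1 h2 h3 h4; exact h4 (le_antisymm (by linarith) (by linarith))) | (norm_num; done)
  have hup : ∀ x ∈ S, ∀ y, x ≤ y → y ∈ S := by
    intro x hx y hxy
    apply Summable.of_abs
    apply Summable.of_nonneg_of_le (fun n => abs_nonneg _) _ (Summable.abs hx)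
    intro n
    rw [abs_mul, abs_mul]
    exact mul_le_mul_of_nonneg_left (hanti _ _ _ hxy) (abs_nonneg _)
  have hS1 : ∀ x0 ∈ S, ∀ x ∈ Ioi x0, ∀ y ∈ Ioi x0, ρr x - G x = ρr y - G y := by
    intro x0 hx0
    classical
    apply lemJ1 u1 u2 E hE ρ ρr hρ G hG hW p (fun n => if x0 < p n then τ n else 0) ?_ _ isOpen_Ioi ordConnected_Ioi
    · intro x hx
      rw [h]; congr 1; apply tsum_congr; intro n
      split_ifs with h1
      · rfl
      · have : Hf (p n) x = 0 := by
          unfold Hf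
          have : p n < x := lt_of_le_of_lt (not_lt.1 h1) hx
          rw [if_neg (by linarith), if_neg (by linarith)]
        rw [this]; simp
    · apply Summable.of_abs
      apply Summable.of_nonneg_of_le (fun n => abs_nonneg _) _ (Summable.abs hx0)
      intro n
      split_ifs with h1
      · simp [Hf, h1]
      · rw [abs_zero]; exact abs_nonneg _
  have hS2 : ∀ x1 ∉ S, ∀ x ∈ Iio x1, ∀ y ∈ Iio x1, ρr x - G x = ρr y - G y := by
    intro x1 hx1
    apply lemJ1 u1 u2 E hE ρ ρr hρ G hG hW p (fun n => 0) summable_zero _ isOpen_Iio ordConnected_Iio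
    intro x hx
    rw [h, tsum_eq_zero_of_not_summable (f := fun n => τ n * Hf (p n) x)]
    · simp
    · intro hs
      exact hx1 (hup x hs x1 (le_of_lt hx))
  intro x y
  by_cases hne : S.Nonempty
  swap
  · rw [not_nonempty_iff_eq_empty] at hne
    exact hS2 (max x y + 1) (by simp [hne]) x (by simp only [mem_Iio]; linarith [le_max_left x y]) y
      (by simp only [mem_Iio]; linarith [le_max_right x y])
  by_cases hbd : BddBelow S
  swap
  · rw [not_bddBelow_iff] at hbd
    obtain ⟨x0, h0, h1⟩ := hbd (min x y)
    exact hS1 x0 h0 x (lt_of_lt_of_le h1 (min_le_left _ _)) y (lt_of_lt_of_le h1 (min_le_right _ _))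
  set z := sInf S
  have hR : ∀ x ∈ Ioi z, ∀ y ∈ Ioi z, ρr x - G x = ρr y - G y := by
    intro x hx y hy
    obtain ⟨x0, h0, h1⟩ := exists_lt_of_csInf_lt hne (lt_min hx hy)
    exact hS1 x0 h0 x (lt_of_lt_of_le h1 (min_le_left _ _)) y (lt_of_lt_of_le h1 (min_le_right _ _))
  have hL : ∀ x ∈ Iio z, ∀ y ∈ Iio z, ρr x - G x = ρr y - G y := by
    intro x hx y hy
    obtain ⟨x1, h1, h2⟩ := exists_between (max_lt (mem_Iio.1 hx) (mem_Iio.1 hy))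
    exact hS2 x1 (fun hh => absurd (csInf_le hbd hh) (not_le.2 h2)) x (lt_of_le_of_lt (le_max_left _ _) h1)
      y (lt_of_le_of_lt (le_max_right _ _) h1)
  have key : ∀ T : Set ℝ, T.Nonempty → (∀ x ∈ T, ∀ y ∈ T, ρr x - G x = ρr y - G y) → z ∈ closure T →
      ∀ x ∈ T, ρr x - G x = ρr z - G z := by
    intro T hT hc hz x hx
    have hcl2 : IsClosed {w | ρr x - G x = ρr w - G w} := isClosed_eq continuous_const hW
    exact closure_minimal (fun w hw => hc x hx w hw) hcl2 hz
  have all : ∀ x, ρr x - G x = ρr z - G z := by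
    intro x
    rcases lt_trichotomy x z with hx | hx | hx
    · exact key (Iio z) ⟨x, hx⟩ hL (by rw [closure_Iio]; simp) x hx
    · rw [hx]
    · exact key (Ioi z) ⟨x, hx⟩ hR (by rw [closure_Ioi]; simp) x hx
  rw [all x, all y]


/-- The analytic data of the map used in the proof: reciprocal derivative e, and k equal to minus its derivative. -/
structure Dyn where
  a : ℝ
  b : ℝ
  c : ℝ
  hac : a < c
  hcb : c < b
  T : ℝ → ℝ
  e : ℝ → ℝ
  k : ℝ → ℝ
  lam : ℝ
  K : ℝ
  lam0 : 0 ≤ lam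
  lam1 : lam < 1
  T_cont : Continuous T
  T_mem : ∀ x, T x ∈ Icc a b
  T_out : ∀ x, x ∉ Ioo a b → T x = a
  T_int : ∀ x ∈ Ioo a b, x ≠ c → T x ∈ Ioo a b
  T_inj1 : InjOn T (Icc a c)
  T_inj2 : InjOn T (Icc c b)
  e_meas : Measurable e
  k_meas : Measurable k
  e_out : ∀ x, x ∉ Ioo a b → e x = 0
  k_out : ∀ x, x ∉ Ioo a b → k x = 0
  e_le : ∀ x, |e x| ≤ lam
  k_le : ∀ x, |k x| ≤ K
  e_ne : ∀ x ∈ Ioo a b, x ≠ c → e x ≠ 0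
  einv_le : ∀ x ∈ Ioo a b, x ≠ c → |(e x)⁻¹| ≤ K
  hT : ∀ x ∈ Ioo a b, x ≠ c → HasDerivAt T (e x)⁻¹ x
  he : ∀ x ∈ Ioo a b, x ≠ c → HasDerivAt e (-k x) x
  hk : ∀ x ∈ Ioo a b, x ≠ c → DifferentiableAt ℝ k x ∧ |deriv k x| ≤ K

lemma branch_facts (g : ℝ → ℝ) (U : Set ℝ) (hU : IsOpen U) (hg : ContDiffOn ℝ 3 g U) (α β κ : ℝ)
    (hs : Icc α β ⊆ U) (hκ : 1 < κ) (hd : ∀ x ∈ U, κ ≤ |deriv g x|) :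
    ∃ K : ℝ, 0 ≤ K ∧ ContinuousOn (deriv g) (Icc α β) ∧
     ContinuousOn (fun x => deriv (deriv g) x / (deriv g x)^2) (Icc α β) ∧ ∀ x ∈ Icc α β,
      HasDerivAt g (deriv g x) x ∧
      HasDerivAt (fun y => (deriv g y)⁻¹) (-(deriv (deriv g) x / (deriv g x)^2)) x ∧
      DifferentiableAt ℝ (fun y => deriv (deriv g) y / (deriv g y)^2) x ∧
      |deriv g x| ≤ K ∧ |deriv (deriv g) x / (deriv g x)^2| ≤ K ∧
      |deriv (fun y => deriv (deriv g) y / (deriv g y)^2) x| ≤ K := by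
  have hne : ∀ x ∈ U, deriv g x ≠ 0 := by
    intro x hx h0
    have := hd x hx
    rw [h0, abs_zero] at this; linarith
  have h1 : ContDiffOn ℝ 2 (deriv g) U := hg.deriv_of_isOpen hU (by norm_num)
  have h2 : ContDiffOn ℝ 1 (deriv (deriv g)) U := h1.deriv_of_isOpen hU (by norm_num)
  have h1' : ContDiffOn ℝ 1 (deriv g) U := h1.of_le (by norm_num)
  have h3 : ContDiffOn ℝ 1 (fun y => deriv (deriv g) y / (deriv g y)^2) U :=
    h2.div (h1'.pow 2) (fun x hx => pow_ne_zero _ (hne x hx))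
  have h4 : ContDiffOn ℝ 0 (deriv (fun y => deriv (deriv g) y / (deriv g y)^2)) U :=
    h3.deriv_of_isOpen hU (by norm_num)
  have c1 : ContinuousOn (deriv g) (Icc α β) := h1.continuousOn.mono hs
  have c2 := h3.continuousOn.mono hs
  have c3 := h4.continuousOn.mono hs
  obtain ⟨K1, hK1⟩ := (isCompact_Icc (a := α) (b := β)).exists_bound_of_continuousOn c1
  obtain ⟨K2, hK2⟩ := (isCompact_Icc (a := α) (b := β)).exists_bound_of_continuousOn c2
  obtain ⟨K3, hK3⟩ := (isCompact_Icc (a := α) (b := β)).exists_bound_of_continuousOn c3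
  refine ⟨max 0 (max K1 (max K2 K3)), le_max_left _ _, c1, c2, fun x hx => ?_⟩
  have hn := hU.mem_nhds (hs hx)
  have d1 : HasDerivAt g (deriv g x) x :=
    ((hg.differentiableOn (by norm_num)).differentiableAt hn).hasDerivAt
  have d2 : HasDerivAt (deriv g) (deriv (deriv g) x) x :=
    ((h1.differentiableOn (by norm_num)).differentiableAt hn).hasDerivAt
  refine ⟨d1, ?_, (h3.differentiableOn (by norm_num)).differentiableAt hn, ?_, ?_, ?_⟩
  · have := d2.inv (hne x (hs hx))
    rw [← neg_div]; exact this
  · exact (hK1 x hx).trans (by simp)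
  · exact (hK2 x hx).trans (by simp)
  · exact (hK3 x hx).trans (by simp)


lemma exists_dyn (F : PWUnimodal 3) : ∃ D : Dyn, D.a = F.a ∧ D.b = F.b ∧
    ∀ x ∈ Icc F.a F.b, D.T x = F.f x := by
  have hac := F.hac
  have hcb := F.hcb
  obtain ⟨K1, hK1, p1, p2, hp⟩ := branch_facts F.fp F.Up F.openUp F.fp_smooth F.a F.c F.κ F.subUp F.one_lt_κ F.fp_exp
  obtain ⟨K2, hK2, q1, q2, hq⟩ := branch_facts F.fm F.Um F.openUm F.fm_smooth F.c F.b F.κ F.subUm F.one_lt_κ F.fm_exp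
  set kp : ℝ → ℝ := fun x => deriv (deriv F.fp) x / (deriv F.fp x)^2
  set km : ℝ → ℝ := fun x => deriv (deriv F.fm) x / (deriv F.fm x)^2
  set T : ℝ → ℝ := fun x => F.f (max F.a (min F.b x)) with hTdef
  set e : ℝ → ℝ := fun x => if x ∈ Ioo F.a F.b then (if x ≤ F.c then (deriv F.fp x)⁻¹ else (deriv F.fm x)⁻¹) else 0 with hedef
  set k : ℝ → ℝ := fun x => if x ∈ Ioo F.a F.b then (if x ≤ F.c then kp x else km x) else 0 with hkdef
  have hcl : ∀ x, max F.a (min F.b x) ∈ Icc F.a F.b := fun x =>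
    ⟨le_max_left _ _, max_le (by linarith) (min_le_left _ _)⟩
  have hTeq : ∀ x ∈ Icc F.a F.b, T x = F.f x := by
    intro x hx
    simp only [hTdef]
    rw [min_eq_right hx.2, max_eq_right hx.1]
  have hTout : ∀ x, x ∉ Ioo F.a F.b → T x = F.a := by
    intro x hx
    simp only [hTdef]
    by_cases h1 : F.a < x
    · have h2 : F.b ≤ x := by by_contra h; exact hx ⟨h1, not_le.1 h⟩
      rw [min_eq_left h2, max_eq_right (by linarith), F.fb]
    · push Not at h1
      rw [max_eq_left ((min_le_right _ _).trans h1), F.fa]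
  have hTp : ∀ x ∈ Ioo F.a F.c, T =ᶠ[𝓝 x] F.fp := by
    intro x hx
    filter_upwards [Ioo_mem_nhds hx.1 hx.2] with y hy
    rw [hTeq y ⟨hy.1.le, by linarith [hy.2]⟩, F.fp_eq ⟨hy.1.le, hy.2.le⟩]
  have hTm : ∀ x ∈ Ioo F.c F.b, T =ᶠ[𝓝 x] F.fm := by
    intro x hx
    filter_upwards [Ioo_mem_nhds hx.1 hx.2] with y hy
    rw [hTeq y ⟨by linarith [hy.1], hy.2.le⟩, F.fm_eq ⟨hy.1.le, hy.2.le⟩]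
  have hep : ∀ x ∈ Ioo F.a F.c, e x = (deriv F.fp x)⁻¹ := by
    intro y hy
    simp only [hedef]
    rw [if_pos ⟨hy.1, by linarith [hy.2]⟩, if_pos hy.2.le]
  have hem : ∀ x ∈ Ioo F.c F.b, e x = (deriv F.fm x)⁻¹ := by
    intro y hy
    simp only [hedef]
    rw [if_pos ⟨by linarith [hy.1], hy.2⟩, if_neg (not_le.2 hy.1)]
  have hkp : ∀ x ∈ Ioo F.a F.c, k x = kp x := by
    intro y hy
    simp only [hkdef]
    rw [if_pos ⟨hy.1, by linarith [hy.2]⟩, if_pos hy.2.le]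
  have hkm : ∀ x ∈ Ioo F.c F.b, k x = km x := by
    intro y hy
    simp only [hkdef]
    rw [if_pos ⟨by linarith [hy.1], hy.2⟩, if_neg (not_le.2 hy.1)]
  have split : ∀ x ∈ Ioo F.a F.b, x ≠ F.c → x ∈ Ioo F.a F.c ∨ x ∈ Ioo F.c F.b := by
    intro x hx hc
    rcases lt_or_gt_of_ne hc with h | h
    · exact Or.inl ⟨hx.1, h⟩
    · exact Or.inr ⟨h, hx.2⟩
  have hκ : 0 < F.κ := by linarith [F.one_lt_κ]
  have hpne : ∀ x ∈ Icc F.a F.c, deriv F.fp x ≠ 0 := by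
    intro x hx h0
    have := F.fp_exp x (F.subUp hx)
    rw [h0, abs_zero] at this; linarith
  have hmne : ∀ x ∈ Icc F.c F.b, deriv F.fm x ≠ 0 := by
    intro x hx h0
    have := F.fm_exp x (F.subUm hx)
    rw [h0, abs_zero] at this; linarith
  have mglue : ∀ g1 g2 : ℝ → ℝ, ContinuousOn g1 (Icc F.a F.c) → ContinuousOn g2 (Icc F.c F.b) →
      Measurable (fun x => if x ∈ Ioo F.a F.b then (if x ≤ F.c then g1 x else g2 x) else 0) := by
    intro g1 g2 h1 h2
    have e1 : (fun x => if x ∈ Ioo F.a F.b then (if x ≤ F.c then g1 x else g2 x) else 0) =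
        fun x => (Ioc F.a F.c).indicator g1 x + (Ioo F.c F.b).indicator g2 x := by
      funext x
      by_cases hx : x ∈ Ioo F.a F.b
      · by_cases hc : x ≤ F.c
        · rw [if_pos hx, if_pos hc, indicator_of_mem (show x ∈ Ioc F.a F.c from ⟨hx.1, hc⟩),
            indicator_of_notMem (by simp only [mem_Ioo, not_and]; intro h; linarith), add_zero]
        · rw [if_pos hx, if_neg hc, indicator_of_notMem (by simp only [mem_Ioc, not_and]; intro _; exact hc),
            indicator_of_mem (show x ∈ Ioo F.c F.b from ⟨not_le.1 hc, hx.2⟩), zero_add]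
      · rw [if_neg hx, indicator_of_notMem (fun h => hx ⟨h.1, by linarith [h.2]⟩),
          indicator_of_notMem (fun h => hx ⟨by linarith [h.1], h.2⟩), add_zero]
    rw [e1]
    apply Measurable.add
    · classical
      have := (h1.mono Ioc_subset_Icc_self).measurable_piecewise (s := Ioc F.a F.c) (g := fun _ => (0:ℝ))
        continuousOn_const measurableSet_Ioc
      rw [← piecewise_eq_indicator]; exact this
    · classical
      have := (h2.mono Ioo_subset_Icc_self).measurable_piecewise (s := Ioo F.c F.b) (g := fun _ => (0:ℝ))
        continuousOn_const measurableSet_Ioo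
      rw [← piecewise_eq_indicator]; exact this
  refine ⟨{ a := F.a, b := F.b, c := F.c, hac := hac, hcb := hcb, T := T, e := e, k := k,
            lam := F.κ⁻¹, K := max K1 K2, lam0 := (inv_pos.2 hκ).le, lam1 := inv_lt_one_of_one_lt₀ F.one_lt_κ,
            T_cont := ?_, T_mem := ?_, T_out := hTout, T_int := ?_, T_inj1 := ?_, T_inj2 := ?_,
            e_meas := ?_, k_meas := ?_, e_out := ?_, k_out := ?_, e_le := ?_, k_le := ?_, e_ne := ?_,
            einv_le := ?_, hT := ?_, he := ?_, hk := ?_ }, rfl, rfl, hTeq⟩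
  · exact F.cont.comp_continuous (by fun_prop) hcl
  · intro x; exact F.mapsI (hcl x)
  · intro x hx hc
    rw [hTeq x ⟨hx.1.le, hx.2.le⟩]
    have hfc : F.f F.c ≤ F.b := (F.mapsI ⟨hac.le, hcb.le⟩).2
    rcases split x hx hc with h | h
    · have m1 := F.mono (left_mem_Icc.2 hac.le) ⟨h.1.le, h.2.le⟩ h.1
      have m2 := F.mono ⟨h.1.le, h.2.le⟩ (right_mem_Icc.2 hac.le) h.2
      rw [F.fa] at m1
      exact ⟨m1, by linarith⟩
    · have m1 := F.anti ⟨h.1.le, h.2.le⟩ (right_mem_Icc.2 hcb.le) h.2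
      have m2 := F.anti (left_mem_Icc.2 hcb.le) ⟨h.1.le, h.2.le⟩ h.1
      rw [F.fb] at m1
      exact ⟨m1, by linarith⟩
  · apply F.mono.injOn.congr
    intro x hx; exact (hTeq x ⟨hx.1, by linarith [hx.2]⟩).symm
  · apply F.anti.injOn.congr
    intro x hx; exact (hTeq x ⟨by linarith [hx.1], hx.2⟩).symm
  · exact mglue _ _ (p1.inv₀ hpne) (q1.inv₀ hmne)
  · exact mglue _ _ p2 q2
  · intro x hx; simp only [hedef]; rw [if_neg hx]
  · intro x hx; simp only [hkdef]; rw [if_neg hx]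
  · intro x
    simp only [hedef]
    split_ifs with h1 h2
    · rw [abs_inv]; exact inv_anti₀ hκ (F.fp_exp x (F.subUp ⟨h1.1.le, h2⟩))
    · rw [abs_inv]; exact inv_anti₀ hκ (F.fm_exp x (F.subUm ⟨(not_le.1 h2).le, h1.2.le⟩))
    · rw [abs_zero]; exact (inv_pos.2 hκ).le
  · intro x
    simp only [hkdef]
    split_ifs with h1 h2
    · exact (hp x ⟨h1.1.le, h2⟩).2.2.2.2.1.trans (le_max_left _ _)
    · exact (hq x ⟨(not_le.1 h2).le, h1.2.le⟩).2.2.2.2.1.trans (le_max_right _ _)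
    · rw [abs_zero]; exact hK1.trans (le_max_left _ _)
  · intro x hx hc
    rcases split x hx hc with h | h
    · rw [hep x h]; exact inv_ne_zero (hpne x ⟨h.1.le, h.2.le⟩)
    · rw [hem x h]; exact inv_ne_zero (hmne x ⟨h.1.le, h.2.le⟩)
  · intro x hx hc
    rcases split x hx hc with h | h
    · rw [hep x h, inv_inv]; exact (hp x ⟨h.1.le, h.2.le⟩).2.2.2.1.trans (le_max_left _ _)
    · rw [hem x h, inv_inv]; exact (hq x ⟨h.1.le, h.2.le⟩).2.2.2.1.trans (le_max_right _ _)
  · intro x hx hc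
    rcases split x hx hc with h | h
    · rw [hep x h, inv_inv]; exact (hp x ⟨h.1.le, h.2.le⟩).1.congr_of_eventuallyEq (hTp x h)
    · rw [hem x h, inv_inv]; exact (hq x ⟨h.1.le, h.2.le⟩).1.congr_of_eventuallyEq (hTm x h)
  · intro x hx hc
    rcases split x hx hc with h | h
    · rw [hkp x h]
      apply (hp x ⟨h.1.le, h.2.le⟩).2.1.congr_of_eventuallyEq
      filter_upwards [Ioo_mem_nhds h.1 h.2] with y hy using hep y hy
    · rw [hkm x h]
      apply (hq x ⟨h.1.le, h.2.le⟩).2.1.congr_of_eventuallyEq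
      filter_upwards [Ioo_mem_nhds h.1 h.2] with y hy using hem y hy
  · intro x hx hc
    rcases split x hx hc with h | h
    · have ev : k =ᶠ[𝓝 x] kp := by
        filter_upwards [Ioo_mem_nhds h.1 h.2] with y hy using hkp y hy
      rw [ev.deriv_eq, ev.differentiableAt_iff]
      have := hp x ⟨h.1.le, h.2.le⟩
      exact ⟨this.2.2.1, this.2.2.2.2.2.trans (le_max_left _ _)⟩
    · have ev : k =ᶠ[𝓝 x] km := by
        filter_upwards [Ioo_mem_nhds h.1 h.2] with y hy using hkm y hy
      rw [ev.deriv_eq, ev.differentiableAt_iff]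
      have := hq x ⟨h.1.le, h.2.le⟩
      exact ⟨this.2.2.1, this.2.2.2.2.2.trans (le_max_right _ _)⟩


/-- The invariant density with a Jordan decomposition off a countable set. -/
structure Dat (D : Dyn) where
  ρ : ℝ → ℝ
  u1 : StieltjesFunction ℝ
  u2 : StieltjesFunction ℝ
  C : ℝ
  E : Set ℝ
  hu1 : ∀ x, |u1 x| ≤ C
  hu2 : ∀ x, |u2 x| ≤ C
  hE : E.Countable
  hEρ : ∀ x ∉ E, ρ x = u1 x - u2 x ∧ ContinuousAt u1 x ∧ ContinuousAt u2 x
  nonneg : ∀ x, 0 ≤ ρ x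
  integrable : Integrable ρ
  supp : ∀ x, x ∉ Icc D.a D.b → ρ x = 0
  inv : ∀ φ : ℝ → ℝ, Continuous φ → (∫ x, φ (D.T x) * ρ x) = ∫ x, φ x * ρ x

namespace Dat
variable {D : Dyn} (X : Dat D)

def m1 : Measure ℝ := X.u1.measure
def m2 : Measure ℝ := X.u2.measure
def ν1 : Measure ℝ := X.m1.restrict X.Eᶜ
def ν2 : Measure ℝ := X.m2.restrict X.Eᶜ

instance : IsFiniteMeasure X.m1 := X.u1.isFiniteMeasure_of_forall_abs_le X.hu1
instance : IsFiniteMeasure X.m2 := X.u2.isFiniteMeasure_of_forall_abs_le X.hu2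
instance : IsFiniteMeasure X.ν1 := by unfold ν1; infer_instance
instance : IsFiniteMeasure X.ν2 := by unfold ν2; infer_instance

lemma noatom_aux (u : StieltjesFunction ℝ) (E : Set ℝ) (h : ∀ x ∉ E, ContinuousAt u x) :
    NullSingletonClass (u.measure.restrict Eᶜ) := by
  constructor
  intro x
  rw [Measure.restrict_apply (measurableSet_singleton x)]
  by_cases hx : x ∈ E
  · convert measure_empty (μ := u.measure)
    ext y; simp only [mem_inter_iff, mem_singleton_iff, mem_compl_iff, mem_empty_iff_false, iff_false]
    rintro ⟨rfl, h2⟩; exact h2 hx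
  · apply measure_mono_null inter_subset_left
    rw [StieltjesFunction.measure_singleton]
    have : Function.leftLim u x = u x := (h x hx).continuousWithinAt.leftLim_eq
    rw [this]; simp

instance : NullSingletonClass X.ν1 := noatom_aux _ _ (fun x hx => (X.hEρ x hx).2.1)
instance : NullSingletonClass X.ν2 := noatom_aux _ _ (fun x hx => (X.hEρ x hx).2.2)

lemma parts (θ : ℝ → ℝ) (hc : Continuous θ) (A B K : ℝ) (h0 : ∀ x, x ≤ A ∨ B ≤ x → θ x = 0)
    (S : Set ℝ) (hS : S.Countable)
    (hd : ∀ x ∉ S, DifferentiableAt ℝ θ x ∧ |deriv θ x| ≤ K) :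
    Integrable (fun x => X.ρ x * deriv θ x) ∧
    ∫ x, X.ρ x * deriv θ x = -(∫ x, θ x ∂X.m1 - ∫ x, θ x ∂X.m2) := by
  obtain ⟨i1, e1⟩ := stieltjes_parts X.u1 X.C X.hu1 θ hc A B K h0 S hS hd
  obtain ⟨i2, e2⟩ := stieltjes_parts X.u2 X.C X.hu2 θ hc A B K h0 S hS hd
  have hae : (fun x => X.ρ x * deriv θ x) =ᵐ[volume]
      fun x => X.u1 x * deriv θ x - X.u2 x * deriv θ x := by
    filter_upwards [X.hE.ae_notMem volume] with x hx
    rw [(X.hEρ x hx).1]; ring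
  constructor
  · exact (i1.sub i2).congr hae.symm
  · rw [integral_congr_ae hae, integral_sub i1 i2, e1, e2]
    unfold m1 m2; ring

lemma test_eq (ψ : ℝ → ℝ) (hψ : ContDiff ℝ (⊤ : ℕ∞) ψ) (hcs : HasCompactSupport ψ)
    (hts : tsupport ψ ⊆ ({D.a, D.T D.c} : Set ℝ)ᶜ) :
    ∫ x, ψ x ∂X.m1 - ∫ x, ψ x ∂X.m2 = (∫ x, D.e x * ψ (D.T x) ∂X.m1 - ∫ x, D.e x * ψ (D.T x) ∂X.m2)
      - ∫ x, X.ρ x * (D.k x * ψ (D.T x)) := by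
  have hd1 : Differentiable ℝ ψ := hψ.differentiable (by norm_num)
  have hdc : Continuous (deriv ψ) := hψ.continuous_deriv (by simp)
  obtain ⟨B, hB⟩ := hcs.exists_bound_of_continuous hψ.continuous
  obtain ⟨B', hB'⟩ := hcs.deriv.exists_bound_of_continuous hdc
  have hder : ∀ x, HasDerivAt (fun x => D.e x * ψ (D.T x)) (deriv ψ (D.T x) - D.k x * ψ (D.T x)) x := by
    intro x
    by_cases hx : x ∈ Ioo D.a D.b ∧ x ≠ D.c
    · have h1 := (hd1 (D.T x)).hasDerivAt.comp x (D.hT x hx.1 hx.2)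
      have h2 := (D.he x hx.1 hx.2).mul h1
      have := D.e_ne x hx.1 hx.2
      refine HasDerivAt.congr_deriv h2 ?_
      change -D.k x * ψ (D.T x) + D.e x * (deriv ψ (D.T x) * (D.e x)⁻¹) = _
      rw [mul_comm (deriv ψ (D.T x)), mul_inv_cancel_left₀ this]
      ring
    · have hTx : D.T x ∉ tsupport ψ := by
        intro h
        apply hts h
        by_cases h1 : x ∈ Ioo D.a D.b
        · have : x = D.c := by by_contra h2; exact hx ⟨h1, h2⟩
          rw [this]; simp
        · rw [D.T_out x h1]; simp
      have h0 : ψ =ᶠ[𝓝 (D.T x)] 0 := notMem_tsupport_iff_eventuallyEq.1 hTx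
      have h1 : (fun x => D.e x * ψ (D.T x)) =ᶠ[𝓝 x] fun _ => 0 := by
        filter_upwards [D.T_cont.continuousAt.eventually h0] with y hy
        rw [hy]; simp
      have h2 : deriv ψ (D.T x) = 0 := by rw [h0.deriv_eq]; simp
      have h3 : ψ (D.T x) = 0 := h0.eq_of_nhds
      rw [h2, h3]; simp only [mul_zero, sub_zero]
      exact (hasDerivAt_const x (0:ℝ)).congr_of_eventuallyEq h1
  have hcont : Continuous (fun x => D.e x * ψ (D.T x)) :=
    continuous_iff_continuousAt.2 (fun x => (hder x).continuousAt)
  obtain ⟨i1, e1⟩ := X.parts (fun x => D.e x * ψ (D.T x)) hcont D.a D.b (B' + D.K * B) (by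
      intro x hx
      rw [D.e_out x (fun h => by rcases hx with hx | hx <;> linarith [h.1, h.2]), zero_mul]) ∅ countable_empty
      (by
        intro x _
        refine ⟨(hder x).differentiableAt, ?_⟩
        rw [(hder x).deriv]
        have b1 := hB' (D.T x)
        have b2 := hB (D.T x)
        have b3 := D.k_le x
        rw [Real.norm_eq_abs] at b1 b2
        calc |deriv ψ (D.T x) - D.k x * ψ (D.T x)| ≤ |deriv ψ (D.T x)| + |D.k x * ψ (D.T x)| := abs_sub _ _
          _ ≤ B' + D.K * B := by
            rw [abs_mul]
            gcongr
            exact (abs_nonneg _).trans b3)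
  obtain ⟨A0, hA0⟩ := hcs.isCompact.isBounded.subset_closedBall 0
  have hz : ∀ x, x ≤ -(A0+1) ∨ (A0+1) ≤ x → ψ x = 0 := by
    intro x hx
    apply image_eq_zero_of_notMem_tsupport
    intro h
    have := hA0 h
    rw [Metric.mem_closedBall, dist_zero_right, Real.norm_eq_abs, abs_le] at this
    rcases hx with hx | hx <;> linarith [this.1, this.2]
  obtain ⟨i2, e2⟩ := X.parts ψ hψ.continuous _ _ B' hz ∅ countable_empty
    (fun x _ => ⟨hd1 x, by simpa using hB' x⟩)
  have e3 := X.inv (deriv ψ) hdc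
  have e4 : ∫ x, X.ρ x * deriv ψ x = ∫ x, X.ρ x * deriv ψ (D.T x) := by
    simp only [mul_comm (X.ρ _)]; exact e3.symm
  have i3 : Integrable (fun x => X.ρ x * (D.k x * ψ (D.T x))) := by
    apply X.integrable.mul_bdd (c := D.K * B)
    · exact (D.k_meas.mul (hψ.continuous.measurable.comp D.T_cont.measurable)).aestronglyMeasurable
    · filter_upwards with x
      have b2 := hB (D.T x)
      have b3 := D.k_le x
      rw [norm_mul]
      have : 0 ≤ D.K := (abs_nonneg _).trans b3
      simp only [Real.norm_eq_abs] at b2 ⊢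
      gcongr
  have e5 : ∫ x, X.ρ x * deriv ψ (D.T x) = (∫ x, X.ρ x * deriv (fun x => D.e x * ψ (D.T x)) x) +
      ∫ x, X.ρ x * (D.k x * ψ (D.T x)) := by
    rw [← integral_add i1 i3]
    congr 1; funext x
    rw [(hder x).deriv]; ring
  linarith

lemma wd (m : Measure ℝ) (T h ψ : ℝ → ℝ) (hT : Measurable T) (hh : Integrable h m) (hψ : Measurable ψ) (B : ℝ)
    (hB : ∀ x, |ψ x| ≤ B) :
    IsFiniteMeasure (Measure.map T (m.withDensity fun x => ENNReal.ofReal (h x))) ∧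
    ∫ x, ψ x ∂(Measure.map T (m.withDensity fun x => ENNReal.ofReal (h x))) = ∫ x, max (h x) 0 * ψ (T x) ∂m := by
  constructor
  · have : IsFiniteMeasure (m.withDensity fun x => ENNReal.ofReal (h x)) := isFiniteMeasure_withDensity_ofReal hh.2
    infer_instance
  · rw [integral_map hT.aemeasurable hψ.aestronglyMeasurable,
      integral_withDensity_eq_integral_toReal_smul₀ hh.1.aemeasurable.ennreal_ofReal (by simp)]
    simp only [ENNReal.toReal_ofReal', smul_eq_mul]

lemma wd_diff (m : Measure ℝ) (T h ψ : ℝ → ℝ) (hT : Measurable T) (hh : Integrable h m) (hψ : Measurable ψ) (B : ℝ)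
    (hB : ∀ x, |ψ x| ≤ B) :
    ∫ x, ψ x ∂(Measure.map T (m.withDensity fun x => ENNReal.ofReal (h x))) -
    ∫ x, ψ x ∂(Measure.map T (m.withDensity fun x => ENNReal.ofReal (-h x))) = ∫ x, h x * ψ (T x) ∂m := by
  rw [(wd m T h ψ hT hh hψ B hB).2, (wd m T (fun x => - h x) ψ hT hh.neg hψ B hB).2]
  rw [← integral_sub]
  · congr 1; funext x
    rw [← sub_mul]; congr 1
    rcases le_total (h x) 0 with h | h
    · rw [max_eq_right h, max_eq_left (by linarith)]; ring
    · rw [max_eq_left h, max_eq_right (by linarith)]; ring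
  · apply hh.pos_part.mul_bdd (c := B) (hψ.comp hT).aestronglyMeasurable
    filter_upwards with x using by simpa using hB (T x)
  · apply hh.neg_part.mul_bdd (c := B) (hψ.comp hT).aestronglyMeasurable
    filter_upwards with x using by simpa using hB (T x)

lemma int_bdd (m : Measure ℝ) [IsFiniteMeasure m] (ψ : ℝ → ℝ) (hψ : Measurable ψ) (B : ℝ)
    (hB : ∀ x, |ψ x| ≤ B) : Integrable ψ m :=
  Integrable.of_bound hψ.aestronglyMeasurable B (by filter_upwards with x using hB x)

lemma full_eq (ψ : ℝ → ℝ) (hψ : Measurable ψ) (B : ℝ) (hB : ∀ x, |ψ x| ≤ B) (ha : ψ D.a = 0)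
    (hc : ψ (D.T D.c) = 0) :
    ∫ x, ψ x ∂X.m1 - ∫ x, ψ x ∂X.m2 = (∫ x, D.e x * ψ (D.T x) ∂X.m1 - ∫ x, D.e x * ψ (D.T x) ∂X.m2)
      - ∫ x, (X.ρ x * D.k x) * ψ (D.T x) := by
  have hTm := D.T_cont.measurable
  have ie1 : Integrable D.e X.m1 := int_bdd _ _ D.e_meas _ D.e_le
  have ie2 : Integrable D.e X.m2 := int_bdd _ _ D.e_meas _ D.e_le
  have ik : Integrable (fun x => X.ρ x * D.k x) := 
    X.integrable.mul_bdd (c := D.K) D.k_meas.aestronglyMeasurable (by filter_upwards with x using D.k_le x)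
  set N := fun (m : Measure ℝ) (h : ℝ → ℝ) => Measure.map D.T (m.withDensity fun x => ENNReal.ofReal (h x)) with hN
  have fin : ∀ (m : Measure ℝ) (h : ℝ → ℝ), Integrable h m → IsFiniteMeasure (N m h) :=
    fun m h hh => (wd m D.T h ψ hTm hh hψ B hB).1
  have f1 := fin X.m1 _ ie1
  have f1' := fin X.m1 (fun x => - D.e x) ie1.neg
  have f2 := fin X.m2 _ ie2
  have f2' := fin X.m2 (fun x => - D.e x) ie2.neg
  have f3 := fin volume _ ik
  have f3' := fin volume (fun x => - (X.ρ x * D.k x)) ik.neg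
  set P := X.m1 + N X.m1 (fun x => - D.e x) + N X.m2 D.e + N volume (fun x => X.ρ x * D.k x)
  set Q := X.m2 + N X.m1 D.e + N X.m2 (fun x => - D.e x) + N volume (fun x => -(X.ρ x * D.k x))
  have key : ∀ (ψ : ℝ → ℝ) (hψ : Measurable ψ) (B : ℝ) (hB : ∀ x, |ψ x| ≤ B),
      ∫ x, ψ x ∂P - ∫ x, ψ x ∂Q = (∫ x, ψ x ∂X.m1 - ∫ x, ψ x ∂X.m2) -
        (∫ x, D.e x * ψ (D.T x) ∂X.m1 - ∫ x, D.e x * ψ (D.T x) ∂X.m2)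
      + ∫ x, (X.ρ x * D.k x) * ψ (D.T x) := by
    intro ψ hψ B hB
    have ii : ∀ (m : Measure ℝ), IsFiniteMeasure m → Integrable ψ m := fun m _ => int_bdd m ψ hψ B hB
    have w1 := wd_diff X.m1 D.T D.e ψ hTm ie1 hψ B hB
    have w2 := wd_diff X.m2 D.T D.e ψ hTm ie2 hψ B hB
    have w3 := wd_diff volume D.T _ ψ hTm ik hψ B hB
    have p1 : ∫ x, ψ x ∂P = ∫ x, ψ x ∂X.m1 + ∫ x, ψ x ∂(N X.m1 (fun x => - D.e x)) + ∫ x, ψ x ∂(N X.m2 D.e)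
        + ∫ x, ψ x ∂(N volume (fun x => X.ρ x * D.k x)) := by
      rw [integral_add_measure (ii _ inferInstance) (ii _ inferInstance),
        integral_add_measure (ii _ inferInstance) (ii _ inferInstance),
        integral_add_measure (ii _ inferInstance) (ii _ inferInstance)]
    have p2 : ∫ x, ψ x ∂Q = ∫ x, ψ x ∂X.m2 + ∫ x, ψ x ∂(N X.m1 D.e) + ∫ x, ψ x ∂(N X.m2 (fun x => - D.e x))
        + ∫ x, ψ x ∂(N volume (fun x => -(X.ρ x * D.k x))) := by
      rw [integral_add_measure (ii _ inferInstance) (ii _ inferInstance),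
        integral_add_measure (ii _ inferInstance) (ii _ inferInstance),
        integral_add_measure (ii _ inferInstance) (ii _ inferInstance)]
    rw [p1, p2]
    simp only [hN]
    linarith
  set O : Set ℝ := ({D.a, D.T D.c} : Set ℝ)ᶜ
  have hO : IsOpen O := (toFinite _).isClosed.isOpen_compl
  have hPQ : P.restrict O = Q.restrict O := by
    apply measure_ext_smooth P Q O hO
    intro ψ h1 h2 h3
    obtain ⟨B, hB⟩ := h2.exists_bound_of_continuous h1.continuous
    have k1 := key ψ h1.continuous.measurable B hB
    have k2 := X.test_eq ψ h1 h2 h3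
    simp only [← mul_assoc] at k2
    linarith
  have hs : ∀ m : Measure ℝ, ∫ x, ψ x ∂(m.restrict O) = ∫ x, ψ x ∂m := by
    intro m
    apply setIntegral_eq_integral_of_forall_compl_eq_zero
    intro x hx
    simp only [O, mem_compl_iff, not_not, mem_insert_iff, mem_singleton_iff] at hx
    rcases hx with rfl | rfl <;> assumption
  have k1 := key ψ hψ B hB
  rw [← hs P, ← hs Q, hPQ] at k1
  linarith
end Dat

namespace Dat
variable {D : Dyn} (X : Dat D)

lemma pre_countable (D : Dyn) (A : Set ℝ) (hA : A.Countable) : (D.T ⁻¹' A ∩ Ioo D.a D.b).Countable := by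
  have h1 : (D.T ⁻¹' A ∩ Icc D.a D.c).Countable :=
    MapsTo.countable_of_injOn (f := D.T) (t := A) (fun x hx => hx.1) (D.T_inj1.mono inter_subset_right) hA
  have h2 : (D.T ⁻¹' A ∩ Icc D.c D.b).Countable :=
    MapsTo.countable_of_injOn (f := D.T) (t := A) (fun x hx => hx.1) (D.T_inj2.mono inter_subset_right) hA
  apply (h1.union h2).mono
  rintro x ⟨hx, hx2⟩
  rcases le_total x D.c with h | h
  · exact Or.inl ⟨hx, hx2.1.le, h⟩
  · exact Or.inr ⟨hx, h, hx2.2.le⟩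

/-- the operator `M`. -/
def MM (D : Dyn) (ψ : ℝ → ℝ) (x : ℝ) : ℝ := D.e x * ψ (D.T x)

lemma nu_eq (ψ : ℝ → ℝ) (hψ : Measurable ψ) (B : ℝ) (hB : ∀ x, |ψ x| ≤ B) :
    ∫ x, ψ x ∂X.ν1 - ∫ x, ψ x ∂X.ν2 = (∫ x, MM D ψ x ∂X.ν1 - ∫ x, MM D ψ x ∂X.ν2)
      - ∫ x, (X.ρ x * D.k x) * ψ (D.T x) := by
  set A' : Set ℝ := X.E ∪ D.T '' X.E ∪ {D.a, D.T D.c} with hA'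
  have hc : A'.Countable := (X.hE.union (X.hE.image _)).union (toFinite _).countable
  have hEA : X.E ⊆ A' := fun x hx => Or.inl (Or.inl hx)
  set ψ' : ℝ → ℝ := A'ᶜ.indicator ψ with hψ'
  have hψ'0 : ∀ x ∈ A', ψ' x = 0 := fun x hx => indicator_of_notMem (s := A'ᶜ) (fun h => h hx) _
  have hψ'1 : ∀ x ∉ A', ψ' x = ψ x := fun x hx => indicator_of_mem (show x ∈ A'ᶜ from hx) _
  have hm : Measurable ψ' := hψ.indicator hc.measurableSet.compl
  have hb : ∀ x, |ψ' x| ≤ B := by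
    intro x
    by_cases hx : x ∈ A'
    · rw [hψ'0 x hx, abs_zero]; exact (abs_nonneg _).trans (hB x)
    · rw [hψ'1 x hx]; exact hB x
  have main := X.full_eq ψ' hm B hb (hψ'0 _ (Or.inr (by simp))) (hψ'0 _ (Or.inr (by simp)))
  have hpc := pre_countable D A' hc
  have r : ∀ (m : Measure ℝ) (g : ℝ → ℝ), (∀ x ∈ X.E, g x = 0) → ∫ x, g x ∂m = ∫ x, g x ∂(m.restrict X.Eᶜ) := by
    intro m g hg
    symm
    apply setIntegral_eq_integral_of_forall_compl_eq_zero
    intro x hx; simp only [mem_compl_iff, not_not] at hx; exact hg x hx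
  have q0 : ∀ (m : Measure ℝ) [NullSingletonClass (m.restrict X.Eᶜ)], ∫ x, ψ' x ∂m = ∫ x, ψ x ∂(m.restrict X.Eᶜ) := by
    intro m _
    rw [r m ψ' (fun x hx => hψ'0 x (hEA hx))]
    apply integral_congr_ae
    filter_upwards [hc.ae_notMem (m.restrict X.Eᶜ)] with x hx using hψ'1 x hx
  have q1 : ∀ (m : Measure ℝ) [NullSingletonClass (m.restrict X.Eᶜ)],
      ∫ x, D.e x * ψ' (D.T x) ∂m = ∫ x, MM D ψ x ∂(m.restrict X.Eᶜ) := by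
    intro m _
    rw [r m (fun x => D.e x * ψ' (D.T x)) (fun x hx => by
      rw [hψ'0 _ (Or.inl (Or.inr ⟨x, hx, rfl⟩)), mul_zero])]
    apply integral_congr_ae
    filter_upwards [hpc.ae_notMem (m.restrict X.Eᶜ)] with x hx
    unfold MM
    by_cases hxI : x ∈ Ioo D.a D.b
    · rw [hψ'1 _ (fun h => hx ⟨h, hxI⟩)]
    · rw [D.e_out x hxI]; simp
  have q2 : ∫ x, (X.ρ x * D.k x) * ψ' (D.T x) = ∫ x, (X.ρ x * D.k x) * ψ (D.T x) := by
    apply integral_congr_ae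
    filter_upwards [hpc.ae_notMem volume] with x hx
    by_cases hxI : x ∈ Ioo D.a D.b
    · rw [hψ'1 _ (fun h => hx ⟨h, hxI⟩)]
    · rw [D.k_out x hxI]; simp
  have n1 : NullSingletonClass (X.m1.restrict X.Eᶜ) := inferInstanceAs (NullSingletonClass X.ν1)
  have n2 : NullSingletonClass (X.m2.restrict X.Eᶜ) := inferInstanceAs (NullSingletonClass X.ν2)
  rw [q0 X.m1, q0 X.m2, q1 X.m1, q1 X.m2, q2] at main
  exact main

lemma MM_meas (ψ : ℝ → ℝ) (hψ : Measurable ψ) : Measurable (MM D ψ) :=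
  D.e_meas.mul (hψ.comp D.T_cont.measurable)

lemma MM_bd (ψ : ℝ → ℝ) (B : ℝ) (hB : ∀ x, |ψ x| ≤ B) : ∀ x, |MM D ψ x| ≤ B := by
  intro x
  unfold MM
  rw [abs_mul]
  have h1 := D.e_le x
  have h2 := D.lam1
  have h3 := hB (D.T x)
  nlinarith [abs_nonneg (D.e x), abs_nonneg (ψ (D.T x))]

lemma MMi (ψ : ℝ → ℝ) (hψ : Measurable ψ) (B : ℝ) (hB : ∀ x, |ψ x| ≤ B) (n : ℕ) :
    Measurable ((MM D)^[n] ψ) ∧ ∀ x, |(MM D)^[n] ψ x| ≤ B := by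
  induction n with
  | zero => exact ⟨hψ, hB⟩
  | succ n ih =>
    rw [Function.iterate_succ_apply']
    exact ⟨MM_meas _ ih.1, MM_bd _ _ ih.2⟩

lemma nu_iter (ψ : ℝ → ℝ) (hψ : Measurable ψ) (B : ℝ) (hB : ∀ x, |ψ x| ≤ B) (N : ℕ) :
    ∫ x, ψ x ∂X.ν1 - ∫ x, ψ x ∂X.ν2 = (∫ x, (MM D)^[N] ψ x ∂X.ν1 - ∫ x, (MM D)^[N] ψ x ∂X.ν2)
      - ∑ j ∈ Finset.range N, ∫ x, (X.ρ x * D.k x) * (MM D)^[j] ψ (D.T x) := by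
  induction N with
  | zero => simp
  | succ n ih =>
    obtain ⟨h1, h2⟩ := MMi (D := D) ψ hψ B hB n
    have := X.nu_eq _ h1 B h2
    rw [Finset.sum_range_succ, Function.iterate_succ_apply', ih, this]; ring

end Dat

namespace Dat
variable {D : Dyn} (X : Dat D)

/-- cofinite filter on the open interval. -/
def LL (D : Dyn) : Filter ℝ := cofinite ⊓ 𝓟 (Ioo D.a D.b)

lemma ev_iff (P : ℝ → Prop) : (∀ᶠ x in LL D, P x) ↔ ∃ S : Finset ℝ, ∀ x ∈ Ioo D.a D.b, x ∉ S → P x := by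
  unfold LL
  rw [eventually_inf_principal, eventually_cofinite]
  constructor
  · intro h
    refine ⟨h.toFinset, fun x hx hS => ?_⟩
    by_contra hP
    exact hS (by rw [Finite.mem_toFinset]; exact fun h => hP (h hx))
  · rintro ⟨S, hS⟩
    apply S.finite_toSet.subset
    intro x hx
    by_contra hxS
    exact hx (fun h => hS x h hxS)

lemma ev_good : ∀ᶠ x in LL D, x ∈ Ioo D.a D.b ∧ x ≠ D.c := by
  rw [ev_iff]
  exact ⟨{D.c}, fun x hx h => ⟨hx, by simpa using h⟩⟩

lemma ev_ae {P : ℝ → Prop} (h : ∀ᶠ x in LL D, P x) (m : Measure ℝ) [NullSingletonClass m] :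
    ∀ᵐ x ∂m, x ∈ Ioo D.a D.b → P x := by
  rw [ev_iff] at h
  obtain ⟨S, hS⟩ := h
  filter_upwards [S.finite_toSet.countable.ae_notMem m] with x hx hI using hS x hI hx

lemma evT {P : ℝ → Prop} (h : ∀ᶠ x in LL D, P x) : ∀ᶠ x in LL D, P (D.T x) := by
  obtain ⟨S, hS⟩ := (ev_iff P).1 h
  have h1 : (D.T ⁻¹' S ∩ Icc D.a D.c).Finite :=
    Finite.of_injOn (f := D.T) (t := S) (fun x hx => hx.1) (D.T_inj1.mono inter_subset_right) S.finite_toSet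
  have h2 : (D.T ⁻¹' S ∩ Icc D.c D.b).Finite :=
    Finite.of_injOn (f := D.T) (t := S) (fun x hx => hx.1) (D.T_inj2.mono inter_subset_right) S.finite_toSet
  have h3 : ∀ᶠ x in LL D, x ∉ (D.T ⁻¹' S ∩ Icc D.a D.c) ∪ (D.T ⁻¹' S ∩ Icc D.c D.b) := by
    rw [ev_iff]
    exact ⟨(h1.union h2).toFinset, fun x _ hx => by rwa [Finite.mem_toFinset] at hx⟩
  filter_upwards [h3, ev_good] with x hx hg
  apply hS _ (D.T_int x hg.1 hg.2)
  intro hT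
  apply hx
  rcases le_total x D.c with h | h
  · exact Or.inl ⟨hT, hg.1.1.le, h⟩
  · exact Or.inr ⟨hT, h, hg.1.2.le⟩

/-- piecewise `C^1` weights with bounds. -/
def PW (D : Dyn) (w : ℝ → ℝ) : Prop :=
  ∃ K : ℝ, 0 ≤ K ∧ ∀ᶠ x in LL D, DifferentiableAt ℝ w x ∧ |w x| ≤ K ∧ |deriv w x| ≤ K

lemma K0 (D : Dyn) : 0 ≤ D.K := (abs_nonneg _).trans (D.k_le 0)

lemma PW.mul {w v : ℝ → ℝ} (hw : PW D w) (hv : PW D v) : PW D (fun x => w x * v x) := by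
  obtain ⟨K, hK, h1⟩ := hw
  obtain ⟨K', hK', h2⟩ := hv
  refine ⟨K * K' + K * K', by positivity, ?_⟩
  filter_upwards [h1, h2] with x ⟨a1, a2, a3⟩ ⟨b1, b2, b3⟩
  refine ⟨a1.mul b1, ?_, ?_⟩
  · rw [abs_mul]
    have : |w x| * |v x| ≤ K * K' := by gcongr
    nlinarith [mul_nonneg hK hK']
  · have hd : deriv (fun x => w x * v x) x = deriv w x * v x + w x * deriv v x := deriv_fun_mul a1 b1
    rw [hd]
    refine (abs_add_le _ _).trans ?_
    rw [abs_mul, abs_mul]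
    gcongr

lemma PW.compT {w : ℝ → ℝ} (hw : PW D w) : PW D (fun x => w (D.T x)) := by
  obtain ⟨K, hK, h1⟩ := hw
  refine ⟨K + K * D.K, by have := K0 D; positivity, ?_⟩
  filter_upwards [evT h1, ev_good] with x ⟨a1, a2, a3⟩ hg
  have hd := a1.hasDerivAt.comp x (D.hT x hg.1 hg.2)
  have := mul_nonneg hK (K0 D)
  refine ⟨hd.differentiableAt, by linarith, ?_⟩
  have e : deriv (fun x => w (D.T x)) x = deriv w (D.T x) * (D.e x)⁻¹ := hd.deriv
  rw [e, abs_mul]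
  have : |deriv w (D.T x)| * |(D.e x)⁻¹| ≤ K * D.K := by
    gcongr; exact D.einv_le x hg.1 hg.2
  linarith

lemma PW_e : PW D D.e := by
  refine ⟨D.lam + D.K, by have := K0 D; have := D.lam0; positivity, ?_⟩
  filter_upwards [ev_good] with x hg
  have h := D.he x hg.1 hg.2
  refine ⟨h.differentiableAt, by linarith [K0 D, D.e_le x], ?_⟩
  rw [h.deriv, abs_neg]; linarith [D.lam0, D.k_le x]

lemma PW_k : PW D D.k := by
  refine ⟨D.K, K0 D, ?_⟩
  filter_upwards [ev_good] with x hg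
  exact ⟨(D.hk x hg.1 hg.2).1, D.k_le x, (D.hk x hg.1 hg.2).2⟩

/-- The reciprocal of the derivative of the iterate of order j. -/
def EE (D : Dyn) : ℕ → ℝ → ℝ
  | 0 => fun _ => 1
  | (j+1) => fun x => D.e x * EE D j (D.T x)

lemma EE_PW (j : ℕ) : PW D (EE D j) := by
  induction j with
  | zero =>
    refine ⟨1, zero_le_one, Eventually.of_forall fun x => ?_⟩
    change DifferentiableAt ℝ (fun _ => (1:ℝ)) x ∧ |(1:ℝ)| ≤ 1 ∧ |deriv (fun _ => (1:ℝ)) x| ≤ 1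
    simp
  | succ j ih => exact PW.mul PW_e ih.compT

lemma EE_le (j : ℕ) (x : ℝ) : |EE D j x| ≤ D.lam ^ j := by
  induction j generalizing x with
  | zero => simp [EE]
  | succ j ih =>
    change |D.e x * EE D j (D.T x)| ≤ _
    rw [abs_mul, pow_succ, mul_comm]
    gcongr
    · exact pow_nonneg D.lam0 _
    · exact ih _
    · exact D.e_le x

lemma MM_EE (j : ℕ) (ψ : ℝ → ℝ) (x : ℝ) : (MM D)^[j] ψ x = EE D j x * ψ (D.T^[j] x) := by
  induction j generalizing x with
  | zero => simp [EE]
  | succ j ih =>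
    rw [Function.iterate_succ_apply', Function.iterate_succ_apply]
    change D.e x * (MM D)^[j] ψ (D.T x) = D.e x * EE D j (D.T x) * _
    rw [ih]; ring

lemma iter_deriv (j : ℕ) : ∀ᶠ x in LL D, EE D j x ≠ 0 ∧ HasDerivAt (D.T^[j]) (EE D j x)⁻¹ x := by
  induction j with
  | zero =>
    refine Eventually.of_forall fun x => ⟨by simp [EE], ?_⟩
    simpa [EE] using hasDerivAt_id x
  | succ j ih =>
    filter_upwards [evT ih, ev_good] with x ⟨h1, h2⟩ hg
    refine ⟨mul_ne_zero (D.e_ne x hg.1 hg.2) h1, ?_⟩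
    rw [Function.iterate_succ]
    have := h2.comp x (D.hT x hg.1 hg.2)
    refine this.congr_deriv ?_
    change _ = (D.e x * EE D j (D.T x))⁻¹
    rw [mul_inv]; ring

lemma evTi {P : ℝ → Prop} (h : ∀ᶠ x in LL D, P x) (j : ℕ) : ∀ᶠ x in LL D, P (D.T^[j] x) := by
  induction j with
  | zero => exact h
  | succ j ih => simp only [Function.iterate_succ_apply]; exact evT ih

/-- a test function with its derivative. -/
structure Pr (D : Dyn) (φ ψ : ℝ → ℝ) (B Λ : ℝ) : Prop where
  cont : ContinuousOn φ (Icc D.a D.b)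
  bd : ∀ x ∈ Icc D.a D.b, |φ x| ≤ B
  meas : Measurable ψ
  Λ0 : 0 ≤ Λ
  bdψ : ∀ x, |ψ x| ≤ Λ
  der : ∀ᶠ x in LL D, HasDerivAt φ (ψ x) x

lemma Dab (D : Dyn) : D.a < D.b := D.hac.trans D.hcb

lemma Pr.B0 {φ ψ : ℝ → ℝ} {B Λ : ℝ} (h : Pr D φ ψ B Λ) : 0 ≤ B :=
  (abs_nonneg _).trans (h.bd D.a (left_mem_Icc.2 (Dab D).le))

lemma Ti_maps (j : ℕ) : MapsTo (D.T^[j]) (Icc D.a D.b) (Icc D.a D.b) :=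
  MapsTo.iterate (fun x _ => D.T_mem x) j

lemma Pr.comp_cont {φ ψ : ℝ → ℝ} {B Λ : ℝ} (h : Pr D φ ψ B Λ) (j : ℕ) :
    ContinuousOn (fun x => φ (D.T^[j] x)) (Icc D.a D.b) :=
  h.cont.comp (D.T_cont.iterate j).continuousOn (Ti_maps j)

lemma Pr.comp_der {φ ψ : ℝ → ℝ} {B Λ : ℝ} (h : Pr D φ ψ B Λ) (j : ℕ) :
    ∀ᶠ x in LL D, EE D j x ≠ 0 ∧ HasDerivAt (fun x => φ (D.T^[j] x)) (ψ (D.T^[j] x) * (EE D j x)⁻¹) x := by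
  filter_upwards [evTi h.der j, iter_deriv j] with x h1 h2
  exact ⟨h2.1, h1.comp x h2.2⟩

lemma jf (w : ℝ → ℝ) (ε : ℝ) (hε : 0 ≤ ε) (hw : PW D w) (hwε : ∀ᶠ x in LL D, |w x| ≤ ε) :
    ∃ C : ℝ, 0 ≤ C ∧ ∀ (φ : ℝ → ℝ) (B : ℝ), ContinuousOn φ (Icc D.a D.b) →
      (∀ x ∈ Icc D.a D.b, |φ x| ≤ B) →
      ∃ φ1 : ℝ → ℝ, ContinuousOn φ1 (Icc D.a D.b) ∧ φ1 D.a = 0 ∧ φ1 D.b = 0 ∧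
        (∀ x ∈ Icc D.a D.b, |φ1 x| ≤ 2 * ε * B) ∧
        ∀ᶠ x in LL D, DifferentiableAt ℝ φ x →
          DifferentiableAt ℝ φ1 x ∧ |w x * deriv φ x - deriv φ1 x| ≤ C * B := by
  obtain ⟨K, hK, h1⟩ := hw
  have h2 : ∀ᶠ x in LL D, DifferentiableAt ℝ w x ∧ |w x| ≤ ε ∧ |deriv w x| ≤ K := by
    filter_upwards [h1, hwε] with x a b using ⟨a.1, b, a.2.2⟩
  obtain ⟨S, hS⟩ := (ev_iff _).1 h2
  obtain ⟨C, hC, h⟩ := jumpfix w ε K hε hK S D.a D.b (Dab D) hS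
  refine ⟨C, hC, fun φ B h3 h4 => ?_⟩
  obtain ⟨φ1, c1, c2, c3, c4, c5⟩ := h φ B h3 h4
  exact ⟨φ1, c1, c2, c3, c4, (ev_iff _).2 ⟨S, c5⟩⟩

lemma termj (j : ℕ) : ∃ C : ℝ, 0 ≤ C ∧ ∀ φ ψ B Λ, Pr D φ ψ B Λ →
    |∫ x, (X.ρ x * D.k x) * (MM D)^[j] ψ (D.T x)| ≤ C * B := by
  set w : ℝ → ℝ := fun x => D.k x * EE D j (D.T x) * EE D (j+1) x with hw
  have hwP : PW D w := (PW_k.mul (EE_PW j).compT).mul (EE_PW (j+1))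
  obtain ⟨K, hK, hKe⟩ := id hwP
  obtain ⟨C, hC, h⟩ := jf w K hK hwP (hKe.mono fun x hx => hx.2.1)
  set M := X.m1.real univ + X.m2.real univ with hM
  have hM0 : 0 ≤ M := by positivity
  set R := ∫ x, X.ρ x with hR
  have hR0 : 0 ≤ R := integral_nonneg X.nonneg
  refine ⟨2 * K * M + C * R, by positivity, ?_⟩
  intro φ ψ B Λ hp
  have hB0 := hp.B0
  obtain ⟨φ2, c1, c2, c3, c4, c5⟩ := h (fun x => φ (D.T^[j+1] x)) B (hp.comp_cont (j+1))
    (fun x hx => hp.bd _ (Ti_maps (j+1) hx))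
  set θ : ℝ → ℝ := (Icc D.a D.b).indicator φ2 with hθ
  have hθ0 : ∀ x, x ≤ D.a ∨ D.b ≤ x → θ x = 0 := by
    intro x hx
    by_cases hxI : x ∈ Icc D.a D.b
    · rw [hθ, indicator_of_mem hxI]
      rcases hx with hx | hx
      · rw [le_antisymm hx hxI.1, c2]
      · rw [le_antisymm hxI.2 hx, c3]
    · rw [hθ, indicator_of_notMem hxI]
  have hθc : Continuous θ := by
    classical
    rw [hθ, ← piecewise_eq_indicator]
    apply continuous_piecewise _ _ continuousOn_const
    · intro x hx
      rw [frontier_Icc (Dab D).le] at hx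
      simp only [mem_insert_iff, mem_singleton_iff] at hx
      rcases hx with rfl | rfl
      · exact c2
      · exact c3
    · rwa [isClosed_Icc.closure_eq]
  have hθb : ∀ x, |θ x| ≤ 2 * K * B := by
    intro x
    by_cases hxI : x ∈ Icc D.a D.b
    · rw [hθ, indicator_of_mem hxI]; exact c4 x hxI
    · rw [hθ, indicator_of_notMem hxI, abs_zero]; positivity
  have hθφ : ∀ x ∈ Ioo D.a D.b, θ =ᶠ[𝓝 x] φ2 := by
    intro x hx
    filter_upwards [Ioo_mem_nhds hx.1 hx.2] with y hy
    rw [hθ, indicator_of_mem (show y ∈ Icc D.a D.b from ⟨hy.1.le, hy.2.le⟩)]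
  have hev : ∀ᶠ x in LL D, DifferentiableAt ℝ θ x ∧
      |D.k x * (MM D)^[j] ψ (D.T x) - deriv θ x| ≤ C * B := by
    filter_upwards [c5, hp.comp_der (j+1), ev_good] with x h1 h2 h3
    have h4 := h1 h2.2.differentiableAt
    have h5 := hθφ x h3.1
    refine ⟨h5.differentiableAt_iff.2 h4.1, ?_⟩
    rw [h5.deriv_eq]
    convert h4.2 using 3
    rw [h2.2.deriv, MM_EE, ← Function.iterate_succ_apply]
    simp only [hw]
    have := h2.1
    field_simp
  have hMi := MMi (D := D) ψ hp.meas Λ hp.bdψ j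
  have hkb : ∀ x, |D.k x * (MM D)^[j] ψ (D.T x)| ≤ D.K * Λ := by
    intro x
    rw [abs_mul]
    have := K0 D
    gcongr
    · exact D.k_le x
    · exact hMi.2 _
  obtain ⟨S, hS⟩ := (ev_iff _).1 hev
  obtain ⟨i1, e1⟩ := X.parts θ hθc D.a D.b (D.K * Λ + C * B) hθ0 (S ∪ {D.a, D.b})
    (S.finite_toSet.countable.union (toFinite _).countable) (by
      intro x hx
      simp only [mem_union, mem_insert_iff, mem_singleton_iff, not_or] at hx
      by_cases hxI : x ∈ Ioo D.a D.b
      · have h1 := hS x hxI hx.1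
        refine ⟨h1.1, ?_⟩
        have h2 := hkb x
        have h3 := abs_sub_abs_le_abs_sub (deriv θ x) (D.k x * (MM D)^[j] ψ (D.T x))
        rw [abs_sub_comm] at h3
        linarith [h1.2]
      · have h1 : θ =ᶠ[𝓝 x] fun _ => 0 := by
          have : x ∈ (Icc D.a D.b)ᶜ := fun h => hxI ⟨lt_of_le_of_ne h.1 (Ne.symm hx.2.1), lt_of_le_of_ne h.2 hx.2.2⟩
          filter_upwards [isClosed_Icc.isOpen_compl.mem_nhds this] with y hy
          exact indicator_of_notMem hy _
        rw [h1.differentiableAt_iff, h1.deriv_eq]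
        refine ⟨differentiableAt_const _, ?_⟩
        have := K0 D
        have := hp.Λ0
        simp only [deriv_const', abs_zero]
        positivity)
  have i2 : Integrable (fun x => (X.ρ x * D.k x) * (MM D)^[j] ψ (D.T x)) := by
    have : Integrable (fun x => X.ρ x * (D.k x * (MM D)^[j] ψ (D.T x))) := by
      apply X.integrable.mul_bdd (c := D.K * Λ)
      · exact (D.k_meas.mul (hMi.1.comp D.T_cont.measurable)).aestronglyMeasurable
      · filter_upwards with x using hkb x
    simpa only [mul_assoc] using this
  have e2 : |∫ x, ((X.ρ x * D.k x) * (MM D)^[j] ψ (D.T x) - X.ρ x * deriv θ x)| ≤ C * B * R := by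
    rw [hR, ← integral_const_mul]
    rw [← Real.norm_eq_abs]
    apply norm_integral_le_of_norm_le (X.integrable.const_mul (C * B))
    filter_upwards [ev_ae hev volume, (toFinite ({D.a, D.b} : Set ℝ)).countable.ae_notMem volume] with x h1 h2
    rw [Real.norm_eq_abs]
    have e : (X.ρ x * D.k x) * (MM D)^[j] ψ (D.T x) - X.ρ x * deriv θ x =
      (D.k x * (MM D)^[j] ψ (D.T x) - deriv θ x) * X.ρ x := by ring
    rw [e, abs_mul, abs_of_nonneg (X.nonneg x)]
    by_cases hxI : x ∈ Ioo D.a D.b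
    · exact mul_le_mul_of_nonneg_right (h1 hxI).2 (X.nonneg x)
    · simp only [mem_insert_iff, mem_singleton_iff, not_or] at h2
      rw [X.supp x (fun h => hxI ⟨lt_of_le_of_ne h.1 (Ne.symm h2.1), lt_of_le_of_ne h.2 h2.2⟩)]
      simp
  rw [integral_sub i2 i1, e1] at e2
  have t1 : |∫ x, θ x ∂X.m1| ≤ 2 * K * B * X.m1.real univ := by
    rw [← Real.norm_eq_abs]
    exact norm_integral_le_of_norm_le_const (Eventually.of_forall hθb)
  have t2 : |∫ x, θ x ∂X.m2| ≤ 2 * K * B * X.m2.real univ := by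
    rw [← Real.norm_eq_abs]
    exact norm_integral_le_of_norm_le_const (Eventually.of_forall hθb)
  rw [abs_le] at *
  constructor <;> simp only [hM] <;> linarith [t1.1, t1.2, t2.1, t2.2, e2.1, e2.2]

end Dat

namespace Dat
variable {D : Dyn} (X : Dat D)

/-- the signed continuous part of the derivative of the density. -/
def nu (ψ : ℝ → ℝ) : ℝ := ∫ x, ψ x ∂X.ν1 - ∫ x, ψ x ∂X.ν2

/-- total mass. -/
def mass : ℝ := X.ν1.real univ + X.ν2.real univ

lemma mass0 : 0 ≤ X.mass := by unfold mass; positivity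

lemma nu_sub (ψ ψ1 : ℝ → ℝ) (h : Measurable ψ) (h1 : Measurable ψ1) (B B1 A : ℝ)
    (hB : ∀ x, |ψ x| ≤ B) (hB1 : ∀ x, |ψ1 x| ≤ B1) (hA : ∃ S : Finset ℝ, ∀ x ∉ S, |ψ x - ψ1 x| ≤ A) :
    |X.nu ψ| ≤ |X.nu ψ1| + A * X.mass := by
  obtain ⟨S, hS⟩ := hA
  have key : ∀ (m : Measure ℝ) [IsFiniteMeasure m] [NullSingletonClass m],
      |∫ x, ψ x ∂m - ∫ x, ψ1 x ∂m| ≤ A * m.real univ := by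
    intro m _ _
    have i1 := int_bdd m ψ h B hB
    have i2 := int_bdd m ψ1 h1 B1 hB1
    rw [← integral_sub i1 i2, ← Real.norm_eq_abs]
    apply norm_integral_le_of_norm_le_const
    filter_upwards [S.finite_toSet.countable.ae_notMem m] with x hx using hS x hx
  have k1 := key X.ν1
  have k2 := key X.ν2
  unfold nu mass
  rw [abs_le] at k1 k2
  have h3 := abs_le.1 (le_refl |∫ x, ψ1 x ∂X.ν1 - ∫ x, ψ1 x ∂X.ν2|)
  rw [abs_le]
  constructor <;> linarith [k1.1, k1.2, k2.1, k2.2, h3.1, h3.2]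

lemma step : ∃ C : ℝ, 0 ≤ C ∧ ∀ φ ψ B Λ, Pr D φ ψ B Λ → ∃ φ1 ψ1,
    Pr D φ1 ψ1 (B/2) (Λ/2 + C * B) ∧ |X.nu ψ| ≤ |X.nu ψ1| + C * B := by
  obtain ⟨N0, hN0⟩ := exists_pow_lt_of_lt_one (show (0:ℝ) < 1/2 by norm_num) D.lam1
  set N := N0 + 1 with hN
  have hl0 : 0 ≤ D.lam ^ N := pow_nonneg D.lam0 _
  have hl : D.lam ^ N ≤ 1/2 := (pow_le_pow_of_le_one D.lam0 D.lam1.le (Nat.le_succ N0)).trans hN0.le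
  set w : ℝ → ℝ := fun x => EE D N x * EE D N x with hw
  obtain ⟨C1, hC1, h1⟩ := jf w (1/4) (by norm_num) ((EE_PW N).mul (EE_PW N)) (by
    refine Eventually.of_forall fun x => ?_
    have := (EE_le (D := D) N x).trans hl
    simp only [hw]
    rw [abs_mul]
    nlinarith [abs_nonneg (EE D N x)])
  choose Cj hCj hj using fun j => X.termj j
  refine ⟨C1 + C1 * X.mass + ∑ j ∈ Finset.range N, Cj j,
    add_nonneg (add_nonneg hC1 (mul_nonneg hC1 X.mass0)) (Finset.sum_nonneg fun j _ => hCj j), ?_⟩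
  intro φ ψ B Λ hp
  have hB0 := hp.B0
  have hS0 : 0 ≤ ∑ j ∈ Finset.range N, Cj j := Finset.sum_nonneg fun j _ => hCj j
  obtain ⟨φ1, c1, -, -, c4, c5⟩ := h1 (fun x => φ (D.T^[N] x)) B (hp.comp_cont N)
    (fun x hx => hp.bd _ (Ti_maps N hx))
  have hMi := MMi (D := D) ψ hp.meas Λ hp.bdψ N
  have hMb : ∀ x, |(MM D)^[N] ψ x| ≤ Λ / 2 := by
    intro x
    rw [MM_EE, abs_mul]
    have h2 := (EE_le (D := D) N x).trans hl
    have h3 := hp.bdψ (D.T^[N] x)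
    have := mul_le_mul h2 h3 (abs_nonneg _) (by norm_num)
    linarith
  have hM0 : ∀ x ∉ Ioo D.a D.b, (MM D)^[N] ψ x = 0 := by
    intro x hx
    rw [MM_EE]
    change D.e x * EE D N0 (D.T x) * _ = 0
    rw [D.e_out x hx]; ring
  have hev : ∀ᶠ x in LL D, DifferentiableAt ℝ φ1 x ∧ |(MM D)^[N] ψ x - deriv φ1 x| ≤ C1 * B := by
    filter_upwards [c5, hp.comp_der N] with x h2 h3
    have h4 := h2 h3.2.differentiableAt
    refine ⟨h4.1, ?_⟩
    convert h4.2 using 3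
    rw [h3.2.deriv, MM_EE]
    simp only [hw]
    have := h3.1
    field_simp
  obtain ⟨S, hS⟩ := (ev_iff _).1 hev
  set ψ1 : ℝ → ℝ := (Ioo D.a D.b \ S).indicator (deriv φ1) with hψ1
  have hms : MeasurableSet (Ioo D.a D.b \ (S : Set ℝ)) := measurableSet_Ioo.diff S.measurableSet
  have hψm : Measurable ψ1 := (measurable_deriv φ1).indicator hms
  have hψb : ∀ x, |ψ1 x| ≤ Λ / 2 + C1 * B := by
    intro x
    by_cases hx : x ∈ Ioo D.a D.b \ (S : Set ℝ)
    · rw [hψ1, indicator_of_mem hx]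
      have h2 := (hS x hx.1 hx.2).2
      have h3 := abs_sub_abs_le_abs_sub (deriv φ1 x) ((MM D)^[N] ψ x)
      rw [abs_sub_comm] at h3
      linarith [hMb x]
    · rw [hψ1, indicator_of_notMem hx, abs_zero]
      have := hp.Λ0
      positivity
  have hA : ∀ x ∉ S, |(MM D)^[N] ψ x - ψ1 x| ≤ C1 * B := by
    intro x hx
    by_cases hI : x ∈ Ioo D.a D.b
    · rw [hψ1, indicator_of_mem (show x ∈ Ioo D.a D.b \ (S : Set ℝ) from ⟨hI, hx⟩)]
      exact (hS x hI hx).2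
    · rw [hψ1, indicator_of_notMem (fun h => hI h.1), hM0 x hI]
      simp only [sub_zero, abs_zero]; positivity
  have hms0 := mul_nonneg hC1 X.mass0
  refine ⟨φ1, ψ1, ⟨c1, ?_, hψm, ?_, ?_, ?_⟩, ?_⟩
  · intro x hx
    have := c4 x hx
    linarith
  · have := hp.Λ0
    positivity
  · intro x
    have := hψb x
    nlinarith
  · rw [ev_iff]
    refine ⟨S, fun x hI hx => ?_⟩
    rw [hψ1, indicator_of_mem (show x ∈ Ioo D.a D.b \ (S : Set ℝ) from ⟨hI, hx⟩)]
    exact (hS x hI hx).1.hasDerivAt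
  · have h2 := X.nu_sub _ ψ1 hMi.1 hψm Λ _ (C1 * B) hMi.2 hψb ⟨S, hA⟩
    have h3 : X.nu ψ = X.nu ((MM D)^[N] ψ)
        - ∑ j ∈ Finset.range N, ∫ x, (X.ρ x * D.k x) * (MM D)^[j] ψ (D.T x) :=
      X.nu_iter ψ hp.meas Λ hp.bdψ N
    have h4 : |∑ j ∈ Finset.range N, ∫ x, (X.ρ x * D.k x) * (MM D)^[j] ψ (D.T x)|
        ≤ (∑ j ∈ Finset.range N, Cj j) * B := by
      rw [Finset.sum_mul]
      exact (Finset.abs_sum_le_sum_abs _ _).trans (Finset.sum_le_sum fun j _ => hj j φ ψ B Λ hp)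
    have h5 := abs_sub (X.nu ((MM D)^[N] ψ))
      (∑ j ∈ Finset.range N, ∫ x, (X.ρ x * D.k x) * (MM D)^[j] ψ (D.T x))
    rw [h3]
    nlinarith [mul_nonneg hC1 hB0]

lemma core : ∃ C : ℝ, 0 ≤ C ∧ ∀ φ ψ B Λ, Pr D φ ψ B Λ → |X.nu ψ| ≤ C * B := by
  obtain ⟨C, hC, h⟩ := X.step
  refine ⟨2 * C, by positivity, ?_⟩
  have hM := X.mass0
  have key : ∀ n : ℕ, ∀ φ ψ B Λ, Pr D φ ψ B Λ →
      |X.nu ψ| ≤ 2 * C * B + X.mass * (Λ + 2 * n * C * B) / 2 ^ n := by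
    intro n
    induction n with
    | zero =>
      intro φ ψ B Λ hp
      have h0 := X.nu_sub ψ (fun _ => 0) hp.meas measurable_const Λ 0 Λ hp.bdψ (by simp)
        ⟨∅, fun x _ => by simpa using hp.bdψ x⟩
      have h1 : X.nu (fun _ => 0) = 0 := by simp [nu]
      rw [h1, abs_zero] at h0
      have := mul_nonneg hC hp.B0
      simp only [Nat.cast_zero, pow_zero, div_one]
      nlinarith
    | succ n ih =>
      intro φ ψ B Λ hp
      obtain ⟨φ1, ψ1, hp1, h1⟩ := h φ ψ B Λ hp
      have h2 := ih φ1 ψ1 _ _ hp1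
      have e : X.mass * (Λ / 2 + C * B + 2 * n * C * (B / 2)) / 2 ^ n
          = X.mass * (Λ + 2 * (n + 1 : ℕ) * C * B) / 2 ^ (n + 1) := by
        push_cast
        field_simp
        ring
      rw [e] at h2
      linarith
  intro φ ψ B Λ hp
  have t1 : Tendsto (fun n : ℕ => ((1:ℝ)/2) ^ n) atTop (𝓝 0) :=
    tendsto_pow_atTop_nhds_zero_of_lt_one (by norm_num) (by norm_num)
  have t2 : Tendsto (fun n : ℕ => (n:ℝ) * ((1:ℝ)/2) ^ n) atTop (𝓝 0) :=
    tendsto_self_mul_const_pow_of_lt_one (by norm_num) (by norm_num)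
  have t3 : Tendsto (fun n : ℕ => 2 * C * B + (X.mass * Λ * ((1:ℝ)/2) ^ n
      + X.mass * (2 * C * B) * ((n:ℝ) * ((1:ℝ)/2) ^ n))) atTop
      (𝓝 (2 * C * B + (X.mass * Λ * 0 + X.mass * (2 * C * B) * 0))) :=
    tendsto_const_nhds.add ((t1.const_mul _).add (t2.const_mul _))
  have t4 : ∀ n : ℕ, |X.nu ψ| ≤ 2 * C * B + (X.mass * Λ * ((1:ℝ)/2) ^ n
      + X.mass * (2 * C * B) * ((n:ℝ) * ((1:ℝ)/2) ^ n)) := by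
    intro n
    refine (key n φ ψ B Λ hp).trans_eq ?_
    rw [div_pow, one_pow]
    field_simp
  have := ge_of_tendsto' t3 t4
  simpa using this

lemma exists_g : ∃ g : ℝ → ℝ, BoundedVariationOn g univ ∧ ∀ x y, x ≤ y →
    (X.ν1.real (Iic y) - X.ν2.real (Iic y)) - (X.ν1.real (Iic x) - X.ν2.real (Iic x))
      = ∫ t in Ioc x y, g t := by
  obtain ⟨C, hC, h⟩ := X.core
  apply riesz_dual X.ν1 X.ν2 C hC
  intro φ B Λ S hφ hB hd
  set ψ : ℝ → ℝ := ((S : Set ℝ)ᶜ).indicator (deriv φ) with hψ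
  have hψS : ∀ x ∉ S, ψ x = deriv φ x := fun x hx => indicator_of_mem (show x ∈ (S : Set ℝ)ᶜ from hx) _
  have hp : Pr D φ ψ B (max Λ 0) := by
    refine ⟨hφ.continuousOn, fun x _ => hB x, (measurable_deriv φ).indicator S.measurableSet.compl,
      le_max_right _ _, fun x => ?_, ?_⟩
    · by_cases hx : x ∈ S
      · rw [hψ, indicator_of_notMem (by simpa using hx)]; simp
      · rw [hψS x hx]; exact (hd x hx).2.trans (le_max_left _ _)
    · rw [ev_iff]
      refine ⟨S, fun x _ hx => ?_⟩
      rw [hψS x hx]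
      exact (hd x hx).1.hasDerivAt
  have h1 := h φ ψ B _ hp
  have key : ∀ (m : Measure ℝ) [NullSingletonClass m], ∫ x, ψ x ∂m = ∫ x, deriv φ x ∂m := by
    intro m _
    apply integral_congr_ae
    filter_upwards [S.finite_toSet.countable.ae_notMem m] with x hx using hψS x hx
  unfold nu at h1
  rwa [key, key] at h1

end Dat

lemma bv_intervalIntegrable (g : ℝ → ℝ) (h : BoundedVariationOn g univ) (x y : ℝ) :
    IntervalIntegrable g volume x y := by
  obtain ⟨p, q, hp, hq, rfl⟩ := h.locallyBoundedVariationOn.exists_monotoneOn_sub_monotoneOn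
  exact (monotoneOn_univ.1 hp).intervalIntegrable.sub (monotoneOn_univ.1 hq).intervalIntegrable

lemma ck_mem (F : PWUnimodal 3) (n : ℕ) : F.ck n ∈ Icc F.a F.b :=
  (F.mapsI.iterate n) ⟨F.hac.le, F.hcb.le⟩

/-- Proposition 3.2. For a mixing piecewise expanding `C³` unimodal map,
the regular part `ρ_reg` of the invariant density belongs to `BV^{(1)}`: it is supported in
`(-∞, b]` and its derivative is a function of bounded variation. -/
theorem stmt_5 (F : PWUnimodal 3) (hmix : F.Mixing)
    (ρ₀ ρreg : ℝ → ℝ) (s : ℕ → ℝ)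
    (hρ₀ : F.IsInvDensity ρ₀) (hdec : F.SaltusDecomp ρ₀ ρreg s) :
    Function.support ρreg ⊆ Set.Iic F.b ∧
    ∃ g : ℝ → ℝ, BoundedVariationOn g Set.univ ∧
      ∀ x, ρreg x = -∫ t in Set.Ioc x F.b, g t := by
  obtain ⟨D, hDa, hDb, hDT⟩ := exists_dyn F
  obtain ⟨u1, u2, C, E, hu1, hu2, hE, hEρ⟩ := bv_stieltjes ρ₀ hρ₀.bv
  have hsupp : ∀ x, x ∉ Icc F.a F.b → ρ₀ x = 0 := by
    intro x hx
    by_contra h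
    exact hx (hρ₀.supp h)
  let X : Dat D :=
    { ρ := ρ₀, u1 := u1, u2 := u2, C := C, E := E, hu1 := hu1, hu2 := hu2, hE := hE, hEρ := hEρ
      nonneg := hρ₀.nonneg
      integrable := hρ₀.integrable
      supp := by rw [hDa, hDb]; exact hsupp
      inv := by
        intro φ hφ
        rw [← hρ₀.invariant φ hφ]
        congr 1
        ext x
        by_cases hx : x ∈ Icc F.a F.b
        · rw [hDT x hx]
        · rw [hsupp x hx]; simp }
  obtain ⟨g, hg, hgG⟩ := X.exists_g
  set G : ℝ → ℝ := fun x => X.ν1.real (Iic x) - X.ν2.real (Iic x) with hG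
  have hGc : Continuous G := by
    have h1 : G = fun x => G 0 + ∫ t in (0:ℝ)..x, g t := by
      ext x
      rcases le_total 0 x with h | h
      · have := hgG 0 x h
        rw [intervalIntegral.integral_of_le h, ← this]
        simp only [hG]; ring
      · have := hgG x 0 h
        rw [intervalIntegral.integral_of_ge h, ← this]
        simp only [hG]; ring
    rw [h1]
    exact continuous_const.add
      (intervalIntegral.continuous_primitive (fun x y => bv_intervalIntegrable g hg x y) 0)
  have hfin1 : IsFiniteMeasure u1.measure := u1.isFiniteMeasure_of_forall_abs_le hu1
  have hfin2 : IsFiniteMeasure u2.measure := u2.isFiniteMeasure_of_forall_abs_le hu2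
  have hIoc : ∀ (m : Measure ℝ) [IsFiniteMeasure m] (x y : ℝ), x ≤ y →
      m.real (Iic y) - m.real (Iic x) = m.real (Ioc x y) := by
    intro m _ x y hxy
    have h0 : Ioc x y = Iic y \ Iic x := by ext t; simp [and_comm]
    rw [h0, measureReal_diff (Iic_subset_Iic.2 hxy) measurableSet_Iic]
  have hGI : ∀ x y, x ≤ y → G y - G x = (u1.measure.restrict Eᶜ).real (Ioc x y) -
      (u2.measure.restrict Eᶜ).real (Ioc x y) := by
    intro x y hxy
    have h1 := hIoc X.ν1 x y hxy
    have h2 := hIoc X.ν2 x y hxy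
    change _ = X.ν1.real (Ioc x y) - X.ν2.real (Ioc x y)
    rw [← h1, ← h2]
    simp only [hG]; ring
  have hconst := lemJ u1 u2 E hE ρ₀ ρreg (fun x hx => (hEρ x hx).1) G hGI (hdec.cont.sub hGc)
    F.ck (fun n => if 1 ≤ n ∧ (n : ℕ∞) ≤ F.Nf then s n else 0) (by
      intro x
      have h1 := hdec.eq x
      have h2 : F.saltus s x =
          ∑' n : ℕ, (if 1 ≤ n ∧ (n : ℕ∞) ≤ F.Nf then s n else 0) * Hf (F.ck n) x := by
        unfold PWUnimodal.saltus sumTo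
        apply tsum_congr
        intro n
        split_ifs
        · rfl
        · simp
      rw [← h2]; linarith)
  have hz : ∀ x, F.b < x → ρreg x = 0 := by
    intro x hx
    have h1 := hdec.eq x
    rw [hsupp x (fun h => absurd h.2 (not_le.2 hx))] at h1
    have h2 : F.saltus s x = 0 := by
      unfold PWUnimodal.saltus sumTo
      have : ∀ n : ℕ, (if 1 ≤ n ∧ (n : ℕ∞) ≤ F.Nf then s n * Hfun (F.ck n) x else 0) = 0 := by
        intro n
        have h3 := (ck_mem F n).2.trans_lt hx
        have h4 : Hfun (F.ck n) x = 0 := by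
          unfold Hfun
          rw [if_neg (not_lt.2 h3.le), if_neg h3.ne']
        rw [h4]; simp
      simp only [this, tsum_zero]
    rw [h2] at h1
    linarith
  have hzb : ρreg F.b = 0 := by
    have h1 : Tendsto ρreg (𝓝[>] F.b) (𝓝 (ρreg F.b)) := hdec.cont.continuousAt.mono_left nhdsWithin_le_nhds
    have h2 : Tendsto ρreg (𝓝[>] F.b) (𝓝 0) := by
      apply tendsto_const_nhds.congr'
      filter_upwards [self_mem_nhdsWithin] with x hx
      exact (hz x hx).symm
    exact tendsto_nhds_unique h1 h2
  refine ⟨fun x hx => ?_, g, hg, fun x => ?_⟩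
  · by_contra h
    exact hx (hz x (not_le.1 h))
  · rcases le_or_gt x F.b with h | h
    · rw [← hgG x F.b h]
      have := hconst x F.b
      simp only [hG] at this
      linarith
    · rw [Ioc_eq_empty (not_lt.2 h.le), hz x h]
      simp
end
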